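/- Let f : ℝⁿ → ℝ be real analytic and let p be a local minimum of f. Then for every sufficiently large integer k there exists an open neighborhood U of p with the following property: for every nonconstant gradient flow γ : [0,∞) → ℝⁿ of f whose image is contained in U, the set Z = {x ∈ ℝⁿ : f(x) − f(p) = ‖x − p‖^{2k}} is intersected by γ at most once, and the intersection is transversal; more precisely, the function τ(t) = f(γ(t)) − f(p) − ‖γ(t) − p‖^{2k} has at most one zero, and τ'(t) < 0 at any zero of τ. -/

import Mathlib

/-- Length additivity: `ℓ(C/fI) = ℓ(C/I) + ℓ(C/f)`. -/
lemma length_quot_mul {C : Type*} [CommRing C] [IsDomain C] (f : C) (hf : f ≠ 0) (I : Ideal C) :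
    Module.length C (C ⧸ (Ideal.span {f} * I)) =
      Module.length C (C ⧸ I) + Module.length C (C ⧸ Ideal.span {f}) := by
  have hle : I ≤ Submodule.comap (LinearMap.mulLeft C f) (Ideal.span {f} * I) := by
    intro x hx
    exact Ideal.mul_mem_mul (Ideal.mem_span_singleton_self f) hx
  refine Module.length_eq_add_of_exact
    (Submodule.mapQ I (Ideal.span {f} * I) (LinearMap.mulLeft C f) hle)
    (Submodule.factor (Ideal.mul_le_left)) ?_ ?_ ?_
  · rw [← LinearMap.ker_eq_bot, LinearMap.ker_eq_bot']
    intro m hm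
    obtain ⟨x, rfl⟩ := Submodule.Quotient.mk_surjective _ m
    rw [Submodule.mapQ_apply, Submodule.Quotient.mk_eq_zero] at hm
    rw [Submodule.Quotient.mk_eq_zero]
    obtain ⟨z, hz, hzx⟩ := Ideal.mem_span_singleton_mul.1 hm
    rw [← mul_left_cancel₀ hf hzx]; exact hz
  · intro y
    obtain ⟨x, rfl⟩ := Submodule.Quotient.mk_surjective _ y
    exact ⟨Submodule.Quotient.mk x, rfl⟩
  · intro y
    obtain ⟨x, rfl⟩ := Submodule.Quotient.mk_surjective _ y
    constructor
    · intro h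
      have h' : (Submodule.Quotient.mk x : C ⧸ Ideal.span {f}) = 0 := h
      rw [Submodule.Quotient.mk_eq_zero, Ideal.mem_span_singleton] at h'
      obtain ⟨z, rfl⟩ := h'
      exact ⟨Submodule.Quotient.mk z, rfl⟩
    · rintro ⟨z, hz⟩
      obtain ⟨z, rfl⟩ := Submodule.Quotient.mk_surjective _ z
      rw [← hz, Submodule.mapQ_apply]
      change (Submodule.Quotient.mk (f * z) : C ⧸ Ideal.span {f}) = 0
      rw [Submodule.Quotient.mk_eq_zero]
      exact Ideal.mul_mem_right _ _ (Ideal.mem_span_singleton_self f)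

lemma length_quot_le {C : Type*} [CommRing C] {I J : Ideal C} (h : I ≤ J) :
    Module.length C (C ⧸ J) ≤ Module.length C (C ⧸ I) :=
  Module.length_le_of_surjective (Submodule.factor h) (Submodule.factor_surjective h)

lemma length_quot_lt {C : Type*} [CommRing C] {I J : Ideal C} (h : I < J)
    [IsNoetherianRing C] (hI : IsArtinian C (C ⧸ I)) :
    Module.length C (C ⧸ J) + 1 ≤ Module.length C (C ⧸ I) := by
  have h1 := Submodule.length_quotient_lt (R := C) (M := C ⧸ I) (J.map (Ideal.Quotient.mk I) |>.restrictScalars C) (by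
    intro hb
    apply not_le_of_gt h
    intro x hx
    have : (Ideal.Quotient.mk I x) ∈ (J.map (Ideal.Quotient.mk I) |>.restrictScalars C) :=
      Ideal.mem_map_of_mem _ hx
    rw [hb] at this
    exact Ideal.Quotient.eq_zero_iff_mem.1 this)
  refine le_trans ?_ (Order.add_one_le_of_lt h1)
  gcongr
  refine Module.length_le_of_surjective (Submodule.liftQ _ (Submodule.factor h.le) ?_) ?_
  · intro x hx
    obtain ⟨x, rfl⟩ := Submodule.Quotient.mk_surjective _ x
    have hx' : Ideal.Quotient.mk I x ∈ J.map (Ideal.Quotient.mk I) := hx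
    rw [Ideal.mem_quotient_iff_mem h.le] at hx'
    rw [LinearMap.mem_ker]
    exact (Submodule.Quotient.mk_eq_zero _).2 hx'
  · intro y
    obtain ⟨x, rfl⟩ := Submodule.Quotient.mk_surjective _ y
    exact ⟨Submodule.Quotient.mk (Submodule.Quotient.mk x), rfl⟩

/-- Bounded chains in a valuation ring above a one-dimensional noetherian domain. -/
lemma chain_bound {C F : Type*} [CommRing C] [IsDomain C] [IsNoetherianRing C]
    [Field F] [Algebra C F] [IsFractionRing C F]
    (hart : ∀ I : Ideal C, I ≠ ⊥ → IsArtinian C (C ⧸ I)) (f : C) (hf : f ≠ 0)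
    (V : ValuationSubring F) (hCV : ∀ c, algebraMap C F c ∈ V) :
    ∃ L : ℕ, ∀ (b : ℕ → F) (l : ℕ), V.valuation (b 0) = V.valuation (algebraMap C F f) →
      (∀ i, b i ∈ V) →
      (∀ i < l, V.valuation (b i) < V.valuation (b (i+1))) → l ≤ L := by
  have hfA := hart (Ideal.span {f}) (by simpa using hf)
  obtain ⟨L, hL⟩ := ENat.ne_top_iff_exists.1 (Module.length_ne_top (R := C) (M := C ⧸ Ideal.span {f}))
  refine ⟨L, fun b l hb0 hbV hlt => ?_⟩
  classical
  obtain ⟨⟨c, hc⟩, hcb⟩ := IsLocalization.exist_integer_multiples_of_finset (nonZeroDivisors C)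
    ((Finset.range (l+1)).image b)
  have hc0 : c ≠ 0 := nonZeroDivisors.ne_zero hc
  have hcF : algebraMap C F c ≠ 0 := by simpa using hc0
  have hcb' : ∀ i, i < l+1 → ∃ d : C, algebraMap C F d = algebraMap C F c * b i := by
    intro i hi
    obtain ⟨d, hd⟩ := hcb (b i) (Finset.mem_image_of_mem _ (Finset.mem_range.2 hi))
    exact ⟨d, by rw [hd]; simp [Algebra.smul_def]⟩
  choose! d hd using hcb'
  let I : Ideal C := Ideal.span (d '' {i | i < l+1})
  -- the ideals of elements with valuation at most that of `c * b i`
  let T : ℕ → Ideal C := fun i =>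
    { carrier := {x | V.valuation (algebraMap C F x) ≤ V.valuation (algebraMap C F c * b i)}
      add_mem' := by
        intro x y hx hy
        simp only [Set.mem_ofPred_eq, map_add] at *
        exact (V.valuation.map_add _ _).trans (max_le hx hy)
      zero_mem' := by simp
      smul_mem' := by
        intro a x hx
        simp only [Set.mem_ofPred_eq, smul_eq_mul, map_mul] at *
        calc _ ≤ 1 * V.valuation (algebraMap C F x) := by
                gcongr; exact (V.valuation_le_one_iff _).2 (hCV a)
          _ ≤ _ := by rw [one_mul]; exact hx }
  have hdT : ∀ i j, i < l+1 → (d i ∈ T j ↔ V.valuation (b i) ≤ V.valuation (b j)) := by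
    intro i j hi
    change V.valuation (algebraMap C F (d i)) ≤ V.valuation (algebraMap C F c * b j) ↔ _
    rw [hd i hi, map_mul, map_mul]
    exact mul_le_mul_iff_right₀ (by
      rw [zero_lt_iff]; simpa using hc0)
  have hfI : ∀ _ : ℕ, Ideal.span {f} * I ≤ I ⊓ T 0 := by
    intro i
    refine le_inf Ideal.mul_le_right ?_
    rw [Ideal.span_mul_span', Ideal.span_le]
    rintro _ ⟨x, rfl, _, ⟨i, hi, rfl⟩, rfl⟩
    change V.valuation (algebraMap C F (x * d i)) ≤ V.valuation (algebraMap C F c * b 0)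
    rw [map_mul, hd i hi, map_mul, map_mul, map_mul, hb0, mul_comm, mul_assoc]
    gcongr
    calc _ ≤ 1 * V.valuation (algebraMap C F x) := by
                gcongr; exact (V.valuation_le_one_iff _).2 (hbV i)
      _ = _ := one_mul _
  have hI0 : I ≠ ⊥ := by
    intro h
    have : d 0 ∈ I := Ideal.subset_span ⟨0, by simp, rfl⟩
    rw [h, Ideal.mem_bot] at this
    have h2 := hd 0 (by omega)
    rw [this, map_zero] at h2
    have h3 : b 0 = 0 := by
      rcases mul_eq_zero.1 h2.symm with h | h
      · exact absurd h hcF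
      · exact h
    rw [h3, map_zero] at hb0
    exact hf (by simpa using hb0.symm)
  have hfI0 : Ideal.span {f} * I ≠ ⊥ := by
    simp only [ne_eq, Ideal.mul_eq_bot, not_or, Ideal.span_singleton_eq_bot]
    exact ⟨hf, hI0⟩
  have hchain : ∀ i, i < l + 1 → Module.length C (C ⧸ (I ⊓ T i)) + i ≤ Module.length C (C ⧸ (I ⊓ T 0)) := by
    intro i
    induction i with
    | zero => intro _; simp
    | succ i ih =>
      intro hi
      have ih := ih (by omega)
      refine le_trans ?_ ih
      have hlti := hlt i (by omega)
      have hne : I ⊓ T i ≠ ⊥ := by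
        intro h
        have : Ideal.span {f} * I ≤ I ⊓ T i := by
          refine (hfI 0).trans (inf_le_inf le_rfl ?_)
          intro x hx
          change V.valuation (algebraMap C F x) ≤ V.valuation (algebraMap C F c * b i)
          refine le_trans (show V.valuation (algebraMap C F x) ≤ V.valuation (algebraMap C F c * b 0) from hx) ?_
          rw [map_mul, map_mul]
          gcongr
          have : ∀ j, j ≤ i → V.valuation (b 0) ≤ V.valuation (b j) := by
            intro j
            induction j with
            | zero => intro _; exact le_rfl
            | succ j ihj => intro hj; exact (ihj (by omega)).trans (hlt j (by omega)).le
          exact this i le_rfl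
        rw [h] at this
        exact hfI0 (le_bot_iff.1 this)
      have hstrict : I ⊓ T i < I ⊓ T (i+1) := by
        refine lt_of_le_of_ne (inf_le_inf le_rfl ?_) ?_
        · intro x hx
          change V.valuation (algebraMap C F x) ≤ V.valuation (algebraMap C F c * b (i+1))
          refine le_trans (show V.valuation (algebraMap C F x) ≤ V.valuation (algebraMap C F c * b i) from hx) ?_
          rw [map_mul, map_mul]
          gcongr
        · intro h
          have h1 : d (i+1) ∈ I ⊓ T (i+1) :=
            ⟨Ideal.subset_span ⟨i+1, hi, rfl⟩, (hdT _ _ hi).2 le_rfl⟩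
          rw [← h] at h1
          exact absurd ((hdT _ _ hi).1 h1.2) (not_le_of_gt hlti)
      have := length_quot_lt hstrict (hart _ hne)
      calc _ = Module.length C (C ⧸ (I ⊓ T (i+1))) + 1 + i := by push_cast; ring
        _ ≤ _ := by gcongr
  have h1 := hchain l (by omega)
  have h2 := length_quot_mul f hf I
  have h3 : Module.length C (C ⧸ I) + l ≤ Module.length C (C ⧸ I) + L := by
    rw [hL, ← h2]
    calc _ ≤ Module.length C (C ⧸ (I ⊓ T l)) + l := by gcongr; exact length_quot_le inf_le_left
      _ ≤ _ := h1
      _ ≤ _ := length_quot_le (hfI 0)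
  have := hart I hI0
  have h4 : Module.length C (C ⧸ I) ≠ ⊤ := Module.length_ne_top
  have := (ENat.add_le_add_iff_left h4).1 h3
  exact_mod_cast this

/-- A Krull–Akizuki type statement. -/
lemma dvr_of_dominating {C F : Type*} [CommRing C] [IsDomain C] [IsNoetherianRing C]
    [IsLocalRing C]
    [Field F] [Algebra C F] [IsFractionRing C F]
    (hart : ∀ I : Ideal C, I ≠ ⊥ → IsArtinian C (C ⧸ I))
    (hprime : ∀ P : Ideal C, P.IsPrime → P ≠ ⊥ → P = IsLocalRing.maximalIdeal C)
    (f : C) (hf : f ≠ 0)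
    (V : ValuationSubring F) (hCV : ∀ c, algebraMap C F c ∈ V)
    (hfV : V.valuation (algebraMap C F f) < 1) :
    IsDiscreteValuationRing V := by
  obtain ⟨L, hL⟩ := chain_bound hart f hf V hCV
  have hf0 : algebraMap C F f ≠ 0 := by simpa using hf
  let φ : C →+* V := (algebraMap C F).codRestrict V.toSubring hCV
  have hφ : ∀ c, ((φ c : V) : F) = algebraMap C F c := fun c => rfl
  have hdvd : ∀ x y : V, V.valuation (x : F) ≤ V.valuation (y : F) → y ∣ x := by
    intro x y h
    obtain ⟨a, ha⟩ := (V.valuation_le_iff _ _).1 h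
    exact ⟨a, by ext; push_cast; rw [← ha]; ring⟩
  have hmax : ∀ x : V, x ∈ IsLocalRing.maximalIdeal V ↔ V.valuation (x : F) < 1 := by
    intro x
    rw [V.valuation_lt_one_iff]
  have hfm : f ∈ IsLocalRing.maximalIdeal C := by
    rw [IsLocalRing.mem_maximalIdeal, mem_nonunits_iff]
    intro hu
    have : φ f ∈ IsLocalRing.maximalIdeal V := (hmax _).2 hfV
    exact this (hu.map φ)
  have hnoeth : IsNoetherianRing V := by
    refine IsNoetherianRing.of_prime fun P hP => ?_
    by_cases hPb : P = ⊥
    · rw [hPb]; exact Submodule.fg_bot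
    -- `f` lies in `P`
    have hfP : φ f ∈ P := by
      obtain ⟨b, hbP, hb0⟩ := Submodule.exists_mem_ne_zero_of_ne_bot hPb
      obtain ⟨c, c', hc', hbc⟩ := IsFractionRing.div_surjective (A := C) (b : F)
      have hc'0 : algebraMap C F c' ≠ 0 := by
        simpa using nonZeroDivisors.ne_zero hc'
      have hcc : φ c = b * φ c' := by
        ext
        push_cast
        rw [hφ, hφ, ← hbc]
        field_simp
      have hcP : c ∈ P.comap φ := by
        rw [Ideal.mem_comap, hcc]; exact Ideal.mul_mem_right _ _ hbP
      have hc0 : c ≠ 0 := by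
        rintro rfl
        apply hb0
        ext
        rw [← hbc]; simp
      have := hprime (P.comap φ) inferInstance (fun h => hc0 (by rw [h] at hcP; simpa using hcP))
      rw [← this] at hfm
      exact hfm
    have hPm : P = IsLocalRing.maximalIdeal V := by
      refine le_antisymm (IsLocalRing.le_maximalIdeal hP.ne_top) ?_
      intro z hz
      by_contra hzP
      have hz1 := (hmax z).1 hz
      have hzj : ∀ j : ℕ, V.valuation (algebraMap C F f) < V.valuation ((z : F) ^ j) := by
        intro j
        by_contra hle
        push Not at hle
        have := hdvd (z ^ j) (φ f) (by push_cast; rw [hφ]; exact hle)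
        exact hzP (hP.mem_of_pow_mem j (P.mem_of_dvd this hfP))
      have hz0 : 0 < V.valuation (z : F) := by
        have := hzj 1
        rw [pow_one] at this
        exact lt_of_le_of_lt zero_le this
      have := hL (fun i => if i = 0 then algebraMap C F f else (z : F) ^ (L + 2 - i)) (L + 1)
        (by simp) (by
          intro i
          split_ifs
          · exact hCV f
          · exact pow_mem z.2 _) (by
          intro i hi
          simp only [Nat.add_eq_zero_iff, one_ne_zero, and_false, if_false]
          split_ifs with h
          · exact hzj _
          · rw [map_pow, map_pow]
            exact pow_lt_pow_right_of_lt_one₀ hz0 hz1 (by omega))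
      omega
    rw [hPm]
    by_contra hfg
    have hstep : ∀ b : V, b ∈ IsLocalRing.maximalIdeal V → ∃ b' ∈ IsLocalRing.maximalIdeal V,
        V.valuation (b : F) < V.valuation (b' : F) := by
      intro b hb
      by_contra hcon
      push Not at hcon
      apply hfg
      refine ⟨{b}, ?_⟩
      apply le_antisymm
      · simpa [Ideal.span_singleton_le_iff_mem] using hb
      · intro x hx
        have := hdvd x b (hcon x hx)
        simpa using Ideal.mem_span_singleton.2 this
    choose! g hg1 hg2 using hstep
    have hit : ∀ i, g^[i] (φ f) ∈ IsLocalRing.maximalIdeal V := by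
      intro i
      induction i with
      | zero => exact (hmax _).2 hfV
      | succ i ih => rw [Function.iterate_succ_apply']; exact hg1 _ ih
    have := hL (fun i => (g^[i] (φ f) : V)) (L+1) rfl (fun i => Subtype.mem _) (by
      intro i _
      rw [Function.iterate_succ_apply']
      exact hg2 _ (hit i))
    omega
  have hnf : ¬ IsField V := by
    intro h
    have h1 : φ f ∈ IsLocalRing.maximalIdeal V := (hmax _).2 hfV
    rw [IsLocalRing.isField_iff_maximalIdeal_eq.1 h, Ideal.mem_bot] at h1
    apply hf0
    rw [← hφ, h1]; rfl
  exact ((IsDiscreteValuationRing.TFAE V hnf).out 0 1).2 (inferInstance : ValuationRing V)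

lemma prime_eq_max {C : Type*} [CommRing C] [IsDomain C] [IsNoetherianRing C]
    [IsLocalRing C] (h : (IsLocalRing.maximalIdeal C).height ≤ 1)
    (P : Ideal C) (hP : P.IsPrime) (hPb : P ≠ ⊥) : P = IsLocalRing.maximalIdeal C := by
  by_contra hne
  have hlt : P < IsLocalRing.maximalIdeal C :=
    lt_of_le_of_ne (IsLocalRing.le_maximalIdeal hP.ne_top) hne
  have h1 := (Ideal.height_le_iff (n := 1)).1 h P hP hlt
  have h2 : P.height = 0 := by
    exact Order.lt_one_iff.1 h1
  rw [Ideal.height_eq_zero_iff, IsDomain.minimalPrimes_eq_singleton_bot] at h2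
  exact hPb h2

lemma artinian_quot {C : Type*} [CommRing C] [IsDomain C] [IsNoetherianRing C]
    [IsLocalRing C] (h : (IsLocalRing.maximalIdeal C).height ≤ 1)
    (I : Ideal C) (hI : I ≠ ⊥) : IsArtinian C (C ⧸ I) := by
  by_cases hT : I = ⊤
  · subst hT
    have : Subsingleton (C ⧸ (⊤ : Ideal C)) := Ideal.Quotient.subsingleton_iff.2 rfl
    infer_instance
  have : IsArtinianRing (C ⧸ I) := by
    apply IsLocalRing.quotient_artinian_of_mem_minimalPrimes_of_isLocalRing
    refine ⟨⟨inferInstance, IsLocalRing.le_maximalIdeal hT⟩, ?_⟩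
    rintro Q ⟨hQ, hIQ⟩ _
    have hQb : Q ≠ ⊥ := fun hb => hI (le_bot_iff.1 (hb ▸ hIQ))
    exact (prime_eq_max h Q hQ hQb).ge
  exact isArtinian_of_surjective_algebraMap (S := C) (R := C ⧸ I) (M := C ⧸ I) Ideal.Quotient.mk_surjective

/-- If no power `f ^ N` lies in `(f, g)^(N+1)`, there is a DVR where `f` is not a unit and
divides all the `g i`. -/
lemma exists_dvr {R : Type*} [CommRing R] [IsDomain R] [IsNoetherianRing R]
    (F : Type*) [Field F] [Algebra R F] [IsFractionRing R F] (f : R) (hf : f ≠ 0)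
    {ι : Type*} [Finite ι] (g : ι → R)
    (h : ∀ N : ℕ, f ^ N ∉ (Ideal.span (insert f (Set.range g))) ^ (N + 1)) :
    ∃ V : ValuationSubring F, IsDiscreteValuationRing V ∧
      (∀ r, algebraMap R F r ∈ V) ∧
      V.valuation (algebraMap R F f) < 1 ∧
      ∀ i, V.valuation (algebraMap R F (g i)) ≤
        V.valuation (algebraMap R F f) := by
  set J := Ideal.span (insert f (Set.range g)) with hJ
  have hfF : algebraMap R F f ≠ 0 := by simpa using hf
  have hfJ : f ∈ J := Ideal.subset_span (Set.mem_insert _ _)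
  have hgJ : ∀ i, g i ∈ J := fun i => Ideal.subset_span (Set.mem_insert_of_mem _ ⟨i, rfl⟩)
  let B : Subalgebra R F := Algebra.adjoin R (Set.range fun i => algebraMap R F (g i) / algebraMap R F f)
  have hB : ∀ y ∈ B, ∃ M : ℕ, ∃ k ∈ J ^ M, y * algebraMap R F f ^ M = algebraMap R F k := by
    intro y hy
    induction hy using Algebra.adjoin_induction with
    | mem x hx =>
      obtain ⟨i, rfl⟩ := hx
      exact ⟨1, g i, by simpa using hgJ i, by field_simp⟩
    | algebraMap r => exact ⟨0, r, by simp, by simp⟩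
    | add x y _ _ hx hy =>
      obtain ⟨M, k, hk, hk'⟩ := hx
      obtain ⟨M', k', hkk, hkk'⟩ := hy
      refine ⟨M + M', k * f ^ M' + f ^ M * k', ?_, ?_⟩
      · rw [pow_add]
        exact add_mem (Ideal.mul_mem_mul hk (Ideal.pow_mem_pow hfJ _))
          (Ideal.mul_mem_mul (Ideal.pow_mem_pow hfJ _) hkk)
      · simp only [map_add, map_mul, map_pow, ← hk', ← hkk']; ring
    | mul x y _ _ hx hy =>
      obtain ⟨M, k, hk, hk'⟩ := hx
      obtain ⟨M', k', hkk, hkk'⟩ := hy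
      refine ⟨M + M', k * k', ?_, ?_⟩
      · rw [pow_add]
        exact Ideal.mul_mem_mul hk hkk
      · simp only [map_mul, ← hk', ← hkk']; ring
  have hinv : (algebraMap R F f)⁻¹ ∉ B := by
    intro hmem
    obtain ⟨M, k, hk, hk'⟩ := hB _ hmem
    apply h M
    have : f ^ M = k * f := by
      apply IsFractionRing.injective R F
      rw [map_mul, ← hk', map_pow]
      field_simp
    rw [this, pow_succ]
    exact Ideal.mul_mem_mul hk hfJ
  have hBft : Algebra.FiniteType R B :=
    (Subalgebra.fg_iff_finiteType B).1 (Subalgebra.fg_def.2 ⟨_, Set.finite_range _, rfl⟩)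
  have hBn : IsNoetherianRing B := Algebra.FiniteType.isNoetherianRing R B
  let S : Subring F := B.toSubring
  have hSn : IsNoetherianRing S := hBn
  have hRS : ∀ r, algebraMap R F r ∈ S := fun r => B.algebraMap_mem r
  let fS : S := ⟨algebraMap R F f, hRS f⟩
  have hfS : Ideal.span {fS} ≠ ⊤ := by
    intro htop
    rw [Ideal.span_singleton_eq_top] at htop
    obtain ⟨u, hu⟩ := htop.exists_right_inv
    apply hinv
    have : (u : F) = (algebraMap R F f)⁻¹ := by
      have := congrArg (Subtype.val) hu
      exact eq_inv_of_mul_eq_one_right this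
    rw [← this]; exact u.2
  obtain ⟨Q, hQ⟩ := Ideal.nonempty_minimalPrimes hfS
  have hQp : Q.IsPrime := hQ.isPrime
  have hfQ : fS ∈ Q := hQ.le (Ideal.mem_span_singleton_self _)
  have hht : Q.height ≤ 1 := Ideal.height_le_one_of_isPrincipal_of_mem_minimalPrimes _ Q hQ
  let C := LocalSubring.ofPrime S Q
  have hCloc : IsLocalRing C.toSubring := C.isLocalRing
  have hCn : IsNoetherianRing C.toSubring := IsLocalization.isNoetherianRing Q.primeCompl _ hSn
  have hdim : (IsLocalRing.maximalIdeal C.toSubring).height ≤ 1 := by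
    have e1 := IsLocalization.AtPrime.ringKrullDim_eq_height Q C.toSubring
    have e2 := IsLocalRing.maximalIdeal_height_eq_ringKrullDim (R := C.toSubring)
    rw [e1] at e2
    have : (IsLocalRing.maximalIdeal C.toSubring).height = Q.height := by exact_mod_cast e2
    rw [this]; exact hht
  have hSC : S ≤ C.toSubring := LocalSubring.le_ofPrime S Q
  have hfrac : IsFractionRing C.toSubring F := by
    refine IsFractionRing.of_field _ _ fun z => ?_
    obtain ⟨a, b, hb, rfl⟩ := IsFractionRing.div_surjective (A := R) z
    exact ⟨⟨_, hSC (hRS a)⟩, ⟨_, hSC (hRS b)⟩, rfl⟩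
  obtain ⟨V, hV⟩ := C.exists_le_valuationSubring
  obtain ⟨hCV, hloc⟩ := LocalSubring.le_def.1 hV
  have hSV : ∀ y ∈ S, y ∈ V := fun y hy => hCV (hSC hy)
  let fC : C.toSubring := ⟨algebraMap R F f, hSC (hRS f)⟩
  have hfC : ¬ IsUnit fC := by
    have := (IsLocalization.AtPrime.isUnit_to_map_iff C.toSubring Q fS).not.2 (by
      simpa [Ideal.primeCompl] using hfQ)
    exact this
  have hfV : V.valuation (algebraMap R F f) < 1 := by
    have h1 : ¬ IsUnit (Subring.inclusion hCV fC) := fun hu => hfC (hloc.map_nonunit _ hu)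
    have := (V.valuation_lt_one_iff ⟨algebraMap R F f, hSV _ (hRS f)⟩).1
      ((IsLocalRing.mem_maximalIdeal _).2 h1)
    exact this
  refine ⟨V, ?_, fun r => hSV _ (hRS r), hfV, ?_⟩
  · exact dvr_of_dominating (C := C.toSubring) (artinian_quot hdim) (prime_eq_max hdim) fC
      (fun h0 => hfF (congrArg Subtype.val h0)) V (fun c => hCV c.2) hfV
  · intro i
    have hm : algebraMap R F (g i) / algebraMap R F f ∈ V :=
      hSV _ (Algebra.subset_adjoin ⟨i, rfl⟩)
    have h1 := (V.valuation_le_one_iff _).2 hm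
    calc _ = V.valuation (algebraMap R F (g i) / algebraMap R F f) * V.valuation (algebraMap R F f) := by
            rw [← map_mul]; congr 1; field_simp
      _ ≤ 1 * _ := by gcongr
      _ = _ := one_mul _

open Polynomial in
/-- The Euler derivation `s d/ds` on a truncated power series ring with coefficient field. -/
lemma exists_euler {κ W : Type*} [Field κ] [CommRing W] (σ : κ →+* W) (s : W) (M : ℕ)
    (hM : s ^ M = 0) (hs : ∀ k < M, s ^ k ≠ 0)
    (hres : ∀ w, ∃ c w', w = σ c + s * w') :
    ∃ δ : W → W, (∀ a b, δ (a + b) = δ a + δ b) ∧ (∀ a b, δ (a * b) = a * δ b + b * δ a) ∧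
      (∀ c, δ (σ c) = 0) ∧ δ s = s ∧ ∀ w, ∃ w', δ w = s * w' := by
  let Φ : κ[X] →+* W := eval₂RingHom σ s
  have hC : ∀ c, Φ (C c) = σ c := fun c => by simp [Φ]
  have hX : Φ X = s := by simp [Φ]
  have hsurj : Function.Surjective Φ := by
    have key : ∀ k w, ∃ P w', w = Φ P + s ^ k * w' := by
      intro k
      induction k with
      | zero => intro w; exact ⟨0, w, by simp⟩
      | succ k ih =>
        intro w
        obtain ⟨P, w', h⟩ := ih w
        obtain ⟨c, w'', h'⟩ := hres w'
        refine ⟨P + X ^ k * C c, w'', ?_⟩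
        rw [h, h', map_add, map_mul, map_pow, hX, hC]; ring
    intro w
    obtain ⟨P, w', h⟩ := key M w
    exact ⟨P, by rw [h, hM]; ring⟩
  have hker : ∀ P, Φ P = 0 → X ^ M ∣ P := by
    intro P hP
    rw [X_pow_dvd_iff]
    intro d
    induction d using Nat.strong_induction_on with
    | _ d ih =>
      intro hd
      have : X ^ d ∣ P := by
        rw [X_pow_dvd_iff]
        intro j hj
        exact ih j hj (hj.trans hd)
      obtain ⟨Q, rfl⟩ := this
      by_contra hne
      have hc : Q.coeff 0 ≠ 0 := by simpa [coeff_X_pow_mul'] using hne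
      rw [map_mul, map_pow, hX] at hP
      have hu : IsUnit (Φ Q) := by
        rw [← Q.divX_mul_X_add, map_add, map_mul, hX, hC]
        refine IsNilpotent.isUnit_add_right_of_commute (u := σ (Q.coeff 0)) ?_ ?_ (Commute.all _ _)
        · exact (Commute.all _ _).isNilpotent_mul_left ⟨M, hM⟩
        · exact (IsUnit.mk0 _ hc).map σ
      exact hs d hd (by simpa using (hu.mul_left_eq_zero).1 hP)
  have hwd : ∀ P Q, Φ P = Φ Q → Φ (X * derivative P) = Φ (X * derivative Q) := by
    intro P Q h
    have h0 : Φ (P - Q) = 0 := by rw [map_sub, h, sub_self]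
    obtain ⟨Y, hY⟩ := hker _ h0
    have hP : P = Q + X ^ M * Y := by rw [← hY]; ring
    have hd : X * derivative P = X * derivative Q + X ^ M * ((M : κ[X]) * Y + X * derivative Y) := by
      rw [hP]
      rcases M with _ | M
      · simp; ring
      · simp; ring
    rw [hd, map_add, map_mul Φ (X ^ M), map_pow, hX, hM]; ring
  let g := Function.surjInv hsurj
  have hg : ∀ w, Φ (g w) = w := Function.surjInv_eq hsurj
  have hδ : ∀ P, Φ (X * derivative (g (Φ P))) = Φ (X * derivative P) := fun P => hwd _ _ (hg _)
  refine ⟨fun w => Φ (X * derivative (g w)), ?_, ?_, ?_, ?_, ?_⟩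
  · intro a b
    have := hδ (g a + g b)
    rw [map_add Φ, hg, hg] at this
    simp only [this, ← map_add]
    congr 1; rw [map_add]; ring
  · intro a b
    have := hδ (g a * g b)
    rw [map_mul Φ (g a), hg, hg] at this
    simp only [this, derivative_mul]
    have h1 : X * (derivative (g a) * g b + g a * derivative (g b)) =
      g a * (X * derivative (g b)) + g b * (X * derivative (g a)) := by ring
    rw [h1, map_add, map_mul _ (g a), map_mul _ (g b), hg, hg]
  · intro c
    have := hδ (C c)
    rw [hC] at this
    simp [this]
  · have := hδ X
    rw [hX] at this
    simp only [this]; simp [hX]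
  · intro w
    exact ⟨Φ (derivative (g w)), by simp only [map_mul, hX]⟩

lemma exists_coeff_field {A W κ : Type} [CommRing A] [IsDomain A] [CharZero A] [CommRing W]
    [Field κ] (α : A →+* W) (π : W →+* κ) (hπ : Function.Surjective π)
    (hnil : IsNilpotent (RingHom.ker π)) (hα : ∀ a, a ≠ 0 → IsUnit (α a)) :
    ∃ σ : κ →+* W, (∀ c, π (σ c) = c) ∧ ∀ a, ∃ c, σ c = α a := by
  let Q := FractionRing A
  let αQ : Q →+* W := IsLocalization.lift (M := nonZeroDivisors A) (g := α)
    (fun y => hα y (nonZeroDivisors.ne_zero y.2))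
  have hαQ : ∀ a, αQ (algebraMap A Q a) = α a := fun a => IsLocalization.lift_eq _ a
  let _ : Algebra Q W := αQ.toAlgebra
  let _ : Algebra Q κ := (π.comp αQ).toAlgebra
  have : CharZero Q := inferInstance
  have hsm : Algebra.FormallySmooth Q κ := by
    obtain ⟨s, hs⟩ := exists_isTranscendenceBasis Q κ
    have := hs.isAlgebraic_field
    exact Algebra.FormallySmooth.of_algebraicIndependent_of_isSeparable hs.1
  let πQ : W →ₐ[Q] κ := { π with commutes' := fun _ => rfl }
  let σ : κ →ₐ[Q] W := Algebra.FormallySmooth.liftOfSurjective (AlgHom.id Q κ) πQ hπ hnil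
  have hσ : ∀ c, π (σ c) = c := fun c =>
    Algebra.FormallySmooth.liftOfSurjective_apply (AlgHom.id Q κ) πQ hπ hnil c
  refine ⟨σ, hσ, fun a => ⟨algebraMap Q κ (algebraMap A Q a), ?_⟩⟩
  have := σ.commutes (algebraMap A Q a)
  exact this.trans (hαQ a)

open IsLocalRing in
lemma core_contradiction {R V : Type} [CommRing R] [CommRing V] [IsDomain V]
    [IsDiscreteValuationRing V] [CharZero (ResidueField V)] (φ : R →+* V) (f : R)
    {ι : Type} [Fintype ι] [DecidableEq ι] (D : ι → R → R)
    (hDadd : ∀ i a b, D i (a + b) = D i a + D i b)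
    (hDmul : ∀ i a b, D i (a * b) = a * D i b + b * D i a)
    (x : ι → R) (hx : ∀ i j, D i (x j) = if i = j then 1 else 0)
    (A : Subring R) (hA : ∀ a ∈ A, a ≠ 0 → IsUnit (φ a))
    (hAx : ∀ j, x j ∈ A ∨ ∀ a ∈ A, D j a = 0)
    (gen : ∀ M r, ∃ q ∈ Subring.closure ((A : Set R) ∪ Set.range x),
      r - q ∈ ((maximalIdeal V).comap φ) ^ M)
    (hf : φ f ≠ 0) (hfn : ¬ IsUnit (φ f)) (hdvd : ∀ i, φ f ∣ φ (D i f)) : False := by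
  obtain ⟨ϖ, hϖ⟩ := IsDiscreteValuationRing.exists_irreducible V
  obtain ⟨e, u, hu⟩ := IsDiscreteValuationRing.eq_unit_mul_pow_irreducible hf hϖ
  have he : e ≠ 0 := by
    rintro rfl
    exact hfn (by rw [hu]; simp)
  have hmax := hϖ.maximalIdeal_eq
  let M := e + 1
  let W := V ⧸ Ideal.span {ϖ ^ M}
  let q : V →+* W := Ideal.Quotient.mk _
  have hq0 : ∀ v, q v = 0 ↔ ϖ ^ M ∣ v := fun v => by
    rw [Ideal.Quotient.eq_zero_iff_mem, Ideal.mem_span_singleton]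
  have hqs : Function.Surjective q := Ideal.Quotient.mk_surjective
  let s := q ϖ
  have hsM : s ^ M = 0 := by rw [← map_pow, hq0]
  have hsk : ∀ k < M, s ^ k ≠ 0 := by
    intro k hk h
    rw [← map_pow, hq0, pow_dvd_pow_iff hϖ.ne_zero hϖ.not_isUnit] at h
    omega
  let π : W →+* ResidueField V := Ideal.Quotient.lift _ (residue V) (by
    intro a ha
    rw [Ideal.mem_span_singleton] at ha
    rw [residue_eq_zero_iff, hmax, Ideal.mem_span_singleton]
    exact (dvd_pow_self ϖ (by omega)).trans ha)
  have hπq : ∀ v, π (q v) = residue V v := fun v => rfl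
  have hπ : Function.Surjective π := by
    intro c
    obtain ⟨v, rfl⟩ := residue_surjective c
    exact ⟨q v, rfl⟩
  have hπ0 : ∀ w, π w = 0 → ∃ w', w = s * w' := by
    intro w hw
    obtain ⟨v, rfl⟩ := hqs w
    rw [hπq, residue_eq_zero_iff, hmax, Ideal.mem_span_singleton] at hw
    obtain ⟨v', rfl⟩ := hw
    exact ⟨q v', by rw [map_mul]⟩
  have hπs : π s = 0 := by
    rw [hπq, residue_eq_zero_iff, hmax, Ideal.mem_span_singleton]
  have hnil : IsNilpotent (RingHom.ker π) := by
    refine ⟨M, ?_⟩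
    have hle : RingHom.ker π ≤ Ideal.span {s} := by
      intro w hw
      obtain ⟨w', rfl⟩ := hπ0 w hw
      exact Ideal.mul_mem_right _ _ (Ideal.mem_span_singleton_self s)
    have := Ideal.pow_right_mono hle M
    rw [Ideal.span_singleton_pow, hsM] at this
    simpa using this
  let α : A →+* W := (q.comp φ).comp A.subtype
  have hφA : Function.Injective (φ.comp A.subtype) := by
    rw [injective_iff_map_eq_zero]
    intro a ha
    by_contra hne
    exact (hA a a.2 (fun h => hne (Subtype.ext h))).ne_zero ha
  have : IsDomain A := hφA.isDomain
  have : CharZero A := RingHom.charZero ((residue V).comp (φ.comp A.subtype))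
  obtain ⟨σ, hσ, hσA⟩ := exists_coeff_field α π hπ hnil (fun a ha =>
    (hA a a.2 (fun h => ha (Subtype.ext h))).map q)
  obtain ⟨δ, δadd, δmul, δσ, δs, δmem⟩ := exists_euler σ s M hsM hsk (by
    intro w
    obtain ⟨w', hw'⟩ := hπ0 (w - σ (π w)) (by rw [map_sub, hσ, sub_self])
    exact ⟨π w, w', by rw [← hw']; ring⟩)
  let ψ := q.comp φ
  have δA : ∀ a ∈ A, δ (ψ a) = 0 := by
    intro a ha
    obtain ⟨c, hc⟩ := hσA ⟨a, ha⟩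
    change σ c = ψ a at hc
    rw [← hc, δσ]
  let E : R → W := fun r => δ (ψ r) - ∑ j, ψ (D j r) * δ (ψ (x j))
  have Eadd : ∀ a b, E (a + b) = E a + E b := by
    intro a b
    simp only [E, map_add, δadd, hDadd, add_mul, Finset.sum_add_distrib]; ring
  have Emul : ∀ a b, E (a * b) = ψ a * E b + ψ b * E a := by
    intro a b
    simp only [E, map_mul, map_add, δmul, hDmul, add_mul, Finset.sum_add_distrib, mul_sub,
      Finset.mul_sum, mul_assoc]; ring
  have Eneg : ∀ a, E (-a) = - E a := by
    intro a
    have h0 : E 0 = 0 := by simpa using Eadd 0 0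
    have := Eadd a (-a)
    rw [add_neg_cancel, h0] at this
    exact (neg_eq_of_add_eq_zero_right this.symm).symm
  have EA : ∀ a ∈ A, E a = 0 := by
    intro a ha
    simp only [E]
    rw [δA a ha, zero_sub, neg_eq_zero]
    refine Finset.sum_eq_zero fun j _ => ?_
    rcases hAx j with h | h
    · rw [δA _ h, mul_zero]
    · rw [h a ha, map_zero, zero_mul]
  have Ex : ∀ j, E (x j) = 0 := by
    intro j
    simp only [E, hx]
    rw [Finset.sum_eq_single j]
    · simp
    · intro i _ hi; simp [hi]
    · simp
  have Ecl : ∀ r ∈ Subring.closure ((A : Set R) ∪ Set.range x), E r = 0 := by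
    intro r hr
    induction hr using Subring.closure_induction with
    | mem y hy =>
      rcases hy with hy | ⟨j, rfl⟩
      · exact EA y hy
      · exact Ex j
    | zero => exact EA 0 A.zero_mem
    | one => exact EA 1 A.one_mem
    | add a b _ _ ha hb => rw [Eadd, ha, hb, add_zero]
    | neg a _ ha => rw [Eneg, ha, neg_zero]
    | mul a b _ _ ha hb => rw [Emul, ha, hb]; simp
  have hψp : ∀ k, ∀ r ∈ ((maximalIdeal V).comap φ) ^ k, s ^ k ∣ ψ r := by
    intro k r hr
    have h1 : r ∈ (((maximalIdeal V) ^ k).comap φ) := Ideal.le_comap_pow φ k hr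
    rw [Ideal.mem_comap, hmax, Ideal.span_singleton_pow, Ideal.mem_span_singleton] at h1
    have := map_dvd q h1
    rwa [map_pow] at this
  have Ep : ∀ k, ∀ r ∈ ((maximalIdeal V).comap φ) ^ (k + 1), s ^ k ∣ E r := by
    intro k
    induction k with
    | zero => intro r _; simp
    | succ k ih =>
      intro r hr
      rw [pow_succ] at hr
      refine Submodule.mul_induction_on hr ?_ ?_
      · intro a ha b hb
        rw [Emul]
        refine dvd_add (Dvd.dvd.mul_right (hψp _ _ ha) _) ?_
        rw [pow_succ' s k]
        refine mul_dvd_mul ?_ (ih a ha)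
        simpa using hψp 1 b (by simpa using hb)
      · intro a b ha hb
        rw [Eadd]; exact dvd_add ha hb
  have E0 : ∀ r, E r = 0 := by
    intro r
    obtain ⟨y, hy, hry⟩ := gen (M + 1) r
    have h1 := Ep M _ hry
    rw [hsM, zero_dvd_iff] at h1
    have : r = (r - y) + y := by ring
    rw [this, Eadd, h1, Ecl y hy, add_zero]
  have hψf : ψ f = q u * s ^ e := by
    change q (φ f) = _
    rw [hu, map_mul, map_pow]
  have hδf : δ (ψ f) = 0 := by
    have := E0 f
    simp only [E] at this
    rw [sub_eq_zero] at this
    rw [this]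
    refine Finset.sum_eq_zero fun j _ => ?_
    obtain ⟨w', hw'⟩ := δmem (ψ (x j))
    obtain ⟨v, hv⟩ := hdvd j
    have : ψ (D j f) = ψ f * q v := by
      change q (φ (D j f)) = q (φ f) * q v
      rw [hv, map_mul]
    rw [this, hw', hψf]
    calc _ = s ^ M * (q u * q v * w') := by simp only [M]; ring
      _ = 0 := by rw [hsM, zero_mul]
  have δ1 : δ 1 = 0 := by
    have := δA 1 A.one_mem
    rwa [map_one] at this
  have δpow : ∀ k : ℕ, δ (s ^ k) = k * s ^ k := by
    intro k
    induction k with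
    | zero => simp [δ1]
    | succ k ih => rw [pow_succ, δmul, ih, δs]; push_cast; ring
  rw [hψf, δmul, δpow] at hδf
  obtain ⟨w', hw'⟩ := δmem (q u)
  have hunit : IsUnit (q u * e + s * w') := by
    have hloc : ∀ w, π w ≠ 0 → IsUnit w := by
      intro w hw
      obtain ⟨v, rfl⟩ := hqs w
      rw [hπq, residue_ne_zero_iff_isUnit] at hw
      exact hw.map q
    apply hloc
    rw [map_add, map_mul, map_mul, hπs, zero_mul, add_zero, map_natCast, hπq]
    refine mul_ne_zero ?_ (Nat.cast_ne_zero.2 he)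
    rw [residue_ne_zero_iff_isUnit]
    exact u.isUnit
  refine hsk e (by omega) ((hunit.mul_left_eq_zero).1 ?_)
  rw [← hδf, hw']; ring

section noether
open IsLocalRing

lemma krull_closed {R : Type*} [CommRing R] [IsNoetherianRing R] [IsLocalRing R] (I : Ideal R)
    (r : R) (h : ∀ S : ℕ, r ∈ I ⊔ (maximalIdeal R) ^ S) : r ∈ I := by
  have hH : IsHausdorff (maximalIdeal R) (R ⧸ I) := IsHausdorff.of_isLocalRing _ _ Ideal.IsPrime.ne_top'
  rw [← Ideal.Quotient.eq_zero_iff_mem]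
  apply hH.haus'
  intro S
  rw [SModEq.zero]
  obtain ⟨y, hy, z, hz, rfl⟩ := Submodule.mem_sup.1 (h S)
  rw [map_add, Ideal.Quotient.eq_zero_iff_mem.2 hy, zero_add]
  have : Ideal.Quotient.mk I z = z • (1 : R ⧸ I) := by
    rw [Algebra.smul_def, mul_one]; rfl
  rw [this]
  exact Submodule.smul_mem_smul hz trivial

lemma adic_sum {R : Type*} [CommRing R] [IsLocalRing R] [IsAdicComplete (maximalIdeal R) R]
    (h : ℕ → R) (hh : ∀ i, h i ∈ maximalIdeal R ^ i) :
    ∃ r, ∀ T, r - ∑ i ∈ Finset.range T, h i ∈ maximalIdeal R ^ T := by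
  obtain ⟨L, hL⟩ := IsPrecomplete.prec' (I := maximalIdeal R) (M := R)
    (fun T => ∑ i ∈ Finset.range T, h i) (by
      intro m n hmn
      rw [SModEq.sub_mem, ← neg_sub, neg_mem_iff]
      rw [← Finset.sum_range_add_sum_Ico _ hmn, add_sub_cancel_left]
      refine sum_mem fun i hi => ?_
      have := Ideal.pow_le_pow_right (I := maximalIdeal R) (Finset.mem_Ico.1 hi).1 (hh i)
      simpa using this)
  refine ⟨L, fun T => ?_⟩
  have := hL T
  rw [SModEq.sub_mem, ← neg_sub, neg_mem_iff] at this
  simpa using this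

variable {K R : Type} [Field K] [CommRing R] [Algebra K R]
  {ι : Type} [Fintype ι] [DecidableEq ι]

/-- Dual systems of coordinates and derivations. -/
def IsCoord [IsLocalRing R] (x : ι → R) (D : ι → Derivation K R R) : Prop :=
  (∀ i j, D i (x j) = if i = j then 1 else 0) ∧ Ideal.span (Set.range x) = maximalIdeal R

lemma coord_change [IsLocalRing R] {x : ι → R} {D : ι → Derivation K R R} (h : IsCoord x D)
    (j : ι) (t : ι → K) (ht : t j = 0) :
    ∃ D' : ι → Derivation K R R, IsCoord (fun i => x i - t i • x j) D' := by
  refine ⟨fun i => if i = j then D j + ∑ k, t k • D k else D i, ?_, ?_⟩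
  · intro i k
    have h1 := h.1
    have hsum : ∀ k, (∑ l, t l • (D l) (x k)) = t k • (1 : R) := by
      intro k
      rw [Finset.sum_eq_single k]
      · simp [h1]
      · intro l _ hl; simp [h1, hl]
      · simp
    by_cases hi : i = j
    · subst hi
      simp only [if_true, map_sub, Derivation.map_smul, Derivation.add_apply]
      have hs : ∀ y, (∑ k, t k • D k) y = ∑ k, t k • D k y := by
        intro y
        rw [← Derivation.coeFnAddMonoidHom_apply, map_sum, Finset.sum_apply]; rfl
      rw [hs, hs, hsum, hsum, h1, h1, ht]
      simp
    · simp only [hi, if_false, map_sub, Derivation.map_smul]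
      rw [h1, h1]
      simp [hi]
  · rw [← h.2]
    apply le_antisymm
    · rw [Ideal.span_le]
      rintro _ ⟨i, rfl⟩
      refine sub_mem (Ideal.subset_span ⟨i, rfl⟩) ?_
      rw [Algebra.smul_def]
      exact Ideal.mul_mem_left _ _ (Ideal.subset_span ⟨j, rfl⟩)
    · rw [Ideal.span_le]
      rintro _ ⟨i, rfl⟩
      have hj : x j ∈ Ideal.span (Set.range fun i => x i - t i • x j) :=
        Ideal.subset_span ⟨j, by simp [ht]⟩
      have : x i = (x i - t i • x j) + algebraMap K R (t i) * x j := by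
        rw [← Algebra.smul_def]; ring
      rw [SetLike.mem_coe, this]
      exact add_mem (Ideal.subset_span ⟨i, rfl⟩) (Ideal.mul_mem_left _ _ hj)

/-- Series in the coordinates indexed by `Y`. -/
def serA (K : Type) {R : Type} [Field K] [CommRing R] [Algebra K R] {ι : Type}
    (x : ι → R) (Y : Finset ι) : Subring R where
  carrier := {a | ∀ T : ℕ, ∃ Q : MvPolynomial Y K,
    a - MvPolynomial.aeval (fun i : Y => x i) Q ∈ (Ideal.span (x '' Y)) ^ T}
  mul_mem' := by
    intro a b ha hb T
    obtain ⟨P, hP⟩ := ha T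
    obtain ⟨Q, hQ⟩ := hb T
    refine ⟨P * Q, ?_⟩
    rw [map_mul]
    have := add_mem (Ideal.mul_mem_left _ a hQ)
      (Ideal.mul_mem_right (MvPolynomial.aeval (fun i : Y => x i) Q) _ hP)
    convert this using 1; ring
  one_mem' := fun T => ⟨1, by simp⟩
  add_mem' := by
    intro a b ha hb T
    obtain ⟨P, hP⟩ := ha T
    obtain ⟨Q, hQ⟩ := hb T
    refine ⟨P + Q, ?_⟩
    rw [map_add]
    have := add_mem hP hQ
    convert this using 1; ring
  zero_mem' := fun T => ⟨0, by simp⟩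
  neg_mem' := by
    intro a ha T
    obtain ⟨P, hP⟩ := ha T
    refine ⟨-P, ?_⟩
    rw [map_neg]
    have := neg_mem hP
    convert this using 1; ring

lemma mem_serA_coord {K R : Type} [Field K] [CommRing R] [Algebra K R] {ι : Type} (x : ι → R) (Y : Finset ι) (j : ι) (hj : j ∈ Y) : x j ∈ serA K x Y :=
  fun T => ⟨MvPolynomial.X ⟨j, hj⟩, by simp⟩

lemma deriv_serA [IsNoetherianRing R] [IsLocalRing R] {x : ι → R} {D : ι → Derivation K R R}
    (h : IsCoord x D) (Y : Finset ι) (j : ι) (hj : j ∉ Y) (a : R) (ha : a ∈ serA K x Y) :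
    D j a = 0 := by
  have hDx : ∀ i ∈ Y, D j (x i) = 0 := by
    intro i hi
    rw [h.1, if_neg]
    rintro rfl; exact hj hi
  have hI : ∀ T, ∀ r ∈ (Ideal.span (x '' Y)) ^ T, D j r ∈ (Ideal.span (x '' Y)) ^ T := by
    intro T
    induction T with
    | zero => intro r _; simp
    | succ T ih =>
      intro r hr
      rw [pow_succ] at hr
      refine Submodule.mul_induction_on hr ?_ ?_
      · intro a ha b hb
        rw [Derivation.leibniz, smul_eq_mul, smul_eq_mul, pow_succ]
        refine add_mem (Ideal.mul_mem_mul ha ?_) ?_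
        · induction hb using Submodule.span_induction with
          | mem y hy =>
            obtain ⟨i, hi, rfl⟩ := hy
            rw [hDx i hi]; exact zero_mem _
          | zero => simp
          | add y z _ _ hy hz => rw [map_add]; exact add_mem hy hz
          | smul c y hy' hy =>
            rw [smul_eq_mul, Derivation.leibniz, smul_eq_mul, smul_eq_mul]
            exact add_mem (Ideal.mul_mem_left _ _ hy) (Ideal.mul_mem_right _ _ hy')
        · rw [mul_comm b]; exact Ideal.mul_mem_mul (ih a ha) hb
      · intro a b ha hb
        rw [map_add]; exact add_mem ha hb
  have hQ : ∀ Q : MvPolynomial Y K, D j (MvPolynomial.aeval (fun i : Y => x i) Q) = 0 := by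
    intro Q
    induction Q using MvPolynomial.induction_on with
    | C c => simp
    | add p q hp hq => rw [map_add, map_add, hp, hq, add_zero]
    | mul_X p i hp =>
      rw [map_mul, Derivation.leibniz, hp, MvPolynomial.aeval_X, hDx i i.2]; simp
  have hle : Ideal.span (x '' Y) ≤ maximalIdeal R := by
    rw [← h.2]; exact Ideal.span_mono (Set.image_subset_range _ _)
  have := krull_closed (⊥ : Ideal R) (D j a) (fun S => by
    obtain ⟨Q, hQ'⟩ := ha S
    have h2 := hI S _ hQ'
    rw [map_sub, hQ, sub_zero] at h2
    exact Ideal.mem_sup_right (Ideal.pow_right_mono hle S h2))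
  simpa using this

end noether

section noether2
open IsLocalRing

variable {K R : Type} [Field K] [CommRing R] [Algebra K R]
  {ι : Type} [Fintype ι] [DecidableEq ι]

lemma aeval_mem_pow {R K : Type} [Field K] [CommRing R] [Algebra K R] {ι : Type} (x : ι → R)
    (Y : Finset ι) (T : ℕ) (Q : MvPolynomial Y K) (hQ : ∀ d, d.degree < T → Q.coeff d = 0) :
    MvPolynomial.aeval (fun i : Y => x i) Q ∈ (Ideal.span (x '' Y)) ^ T := by
  have h1 := (MvPolynomial.mem_pow_idealOfVars_iff' T Q).2 hQ
  have h2 := Ideal.mem_map_of_mem (MvPolynomial.aeval (R := K) (fun i : Y => x i)) h1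
  rw [Ideal.map_pow] at h2
  refine Ideal.pow_right_mono ?_ T h2
  rw [MvPolynomial.idealOfVars, Ideal.map_span, Ideal.span_le]
  rintro _ ⟨_, ⟨i, rfl⟩, rfl⟩
  simp only [MvPolynomial.aeval_X]
  exact Ideal.subset_span ⟨i, i.2, rfl⟩

lemma aeval_smul_homog {S : Type} [CommRing S] [Algebra K S] {τ : Type} [Fintype τ]
    (Q : MvPolynomial τ K) (b : ℕ)
    (hQ : Q.IsHomogeneous b) (c : τ → K) (η : S) :
    MvPolynomial.aeval (fun i => algebraMap K S (c i) * η) Q =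
      algebraMap K S (MvPolynomial.eval c Q) * η ^ b := by
  rw [MvPolynomial.aeval_def, MvPolynomial.eval₂_eq', MvPolynomial.eval_eq', map_sum,
    Finset.sum_mul]
  refine Finset.sum_congr rfl fun d hd => ?_
  have hdeg : ∑ i, d i = b := by
    have := hQ (MvPolynomial.mem_support_iff.1 hd)
    rw [← this, Finsupp.weight_apply, Finsupp.sum_fintype]
    · simp
    · simp
  simp only [mul_pow, Finset.prod_mul_distrib, Finset.prod_pow_eq_pow_sum, hdeg, map_mul, map_prod,
    map_pow, mul_assoc]

lemma serA_drop [Infinite K] [IsNoetherianRing R] [IsLocalRing R] {x : ι → R}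
    {D : ι → Derivation K R R} (h : IsCoord x D) (Y : Finset ι) (P : Ideal R)
    (hP : P ≤ maximalIdeal R) (m : ℕ) (hm : maximalIdeal R ^ m ≤ P ⊔ Ideal.span (x '' Y))
    (a : R) (ha : a ∈ serA K x Y) (haP : a ∈ P) (ha0 : a ≠ 0) :
    ∃ (x' : ι → R) (D' : ι → Derivation K R R), IsCoord x' D' ∧
      ∃ Y' : Finset ι, Y'.card < Y.card ∧
        ∃ m', maximalIdeal R ^ m' ≤ P ⊔ Ideal.span (x' '' Y') := by
  have hle : Ideal.span (x '' Y) ≤ maximalIdeal R := by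
    rw [← h.2]; exact Ideal.span_mono (Set.image_subset_range _ _)
  have hxm : ∀ i, x i ∈ maximalIdeal R := fun i => by
    rw [← h.2]; exact Ideal.subset_span ⟨i, rfl⟩
  obtain ⟨T, hT⟩ : ∃ T, a ∉ (Ideal.span (x '' Y)) ^ T := by
    by_contra! hcon
    refine ha0 ?_
    have := krull_closed (⊥ : Ideal R) a (fun S =>
      Ideal.mem_sup_right (Ideal.pow_right_mono hle S (hcon S)))
    simpa using this
  obtain ⟨Q, hQ⟩ := ha T
  have hex : ∃ b, b < T ∧ MvPolynomial.homogeneousComponent b Q ≠ 0 := by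
    by_contra! hcon
    apply hT
    have := aeval_mem_pow x Y T Q (fun d hd => by
      have := congrArg (MvPolynomial.coeff d) (hcon _ hd)
      simpa [MvPolynomial.coeff_homogeneousComponent] using this)
    have := add_mem hQ this
    simpa using this
  classical
  let b := Nat.find hex
  obtain ⟨hbT, hb0⟩ : b < T ∧ MvPolynomial.homogeneousComponent b Q ≠ 0 := Nat.find_spec hex
  have hbmin : ∀ i < b, MvPolynomial.homogeneousComponent i Q = 0 := by
    intro i hi
    have := Nat.find_min hex hi
    by_contra hne
    exact this ⟨hi.trans hbT, hne⟩
  set q := MvPolynomial.homogeneousComponent b Q with hq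
  have hqh : q.IsHomogeneous b := MvPolynomial.homogeneousComponent_isHomogeneous b Q
  have haq : a - MvPolynomial.aeval (fun i : Y => x i) q ∈ (Ideal.span (x '' Y)) ^ (b + 1) := by
    have h1 := aeval_mem_pow x Y (b + 1) (Q - q) (fun d hd => by
      rw [MvPolynomial.coeff_sub, hq, MvPolynomial.coeff_homogeneousComponent]
      split_ifs with hdb
      · simp
      · have := congrArg (MvPolynomial.coeff d) (hbmin d.degree (by omega))
        simpa [MvPolynomial.coeff_homogeneousComponent] using this)
    have h2 := Ideal.pow_le_pow_right (I := Ideal.span (x '' Y)) (show b + 1 ≤ T by omega) hQ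
    have := add_mem h2 h1
    rw [map_sub] at this
    convert this using 1; ring
  obtain ⟨c, hc⟩ : ∃ c : Y → K, MvPolynomial.eval c q ≠ 0 := by
    by_contra! hcon
    exact hb0 (MvPolynomial.funext (fun c => by rw [hcon c, map_zero]))
  obtain ⟨j, hj⟩ : ∃ j, c j ≠ 0 := by
    by_contra! hcon
    have hc0 : c = fun i => algebraMap K K 0 * 0 := by ext i; simp [hcon]
    by_cases hbz : b = 0
    · have h1 := aeval_smul_homog q b hqh (fun _ => (0 : K)) (0 : R)
      have h2 : MvPolynomial.aeval (fun i : Y => x i) q =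
          algebraMap K R (MvPolynomial.eval c q) := by
        have : q = MvPolynomial.C (MvPolynomial.coeff 0 Q) := by
          rw [hq, hbz, MvPolynomial.homogeneousComponent_zero]
        rw [this]; simp
      rw [h2] at haq
      have h3 : algebraMap K R (MvPolynomial.eval c q) ∈ maximalIdeal R := by
        have h4 := Ideal.pow_le_self (by omega) (Ideal.pow_right_mono hle (b+1) haq)
        have := sub_mem (hP haP) h4
        simpa using this
      exact (mem_maximalIdeal _).1 h3 ((IsUnit.mk0 _ hc).map _)
    · have h1 := aeval_smul_homog q b hqh (fun _ => (0 : K)) (0 : K)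
      apply hc
      rw [hc0]
      rw [zero_pow hbz, mul_zero] at h1
      simpa [MvPolynomial.aeval_def, MvPolynomial.eval₂_id] using h1
  let t : ι → K := fun i => if hi : i ∈ Y then (if i = j then 0 else c ⟨i, hi⟩ / c j) else 0
  have htj : t j = 0 := by simp [t]
  obtain ⟨D', hD'⟩ := coord_change h j t htj
  refine ⟨_, D', hD', Y.erase j, Finset.card_erase_lt_of_mem j.2, m * b, ?_⟩
  set x' : ι → R := fun i => x i - t i • x j with hx'
  let I := P ⊔ Ideal.span (x' '' ↑(Y.erase (j : ι)))
  let S := R ⧸ I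
  let π : R →ₐ[K] S := Ideal.Quotient.mkₐ K I
  have hπ0 : ∀ r, π r = 0 ↔ r ∈ I := fun r => Ideal.Quotient.eq_zero_iff_mem
  let η : S := algebraMap K S (c j)⁻¹ * π (x j)
  have hηj : π (x j) = algebraMap K S (c j) * η := by
    simp only [η]; rw [← mul_assoc, ← map_mul, mul_inv_cancel₀ hj, map_one, one_mul]
  have hπx : ∀ i : Y, π (x i) = algebraMap K S (c i) * η := by
    intro i
    by_cases hij : (i : ι) = j
    · have : i = j := Subtype.ext hij
      rw [this, hηj]
    · have h1 : x' i ∈ I := Ideal.mem_sup_right (Ideal.subset_span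
        ⟨i, Finset.mem_coe.2 (Finset.mem_erase.2 ⟨hij, i.2⟩), rfl⟩)
      have h2 := (hπ0 _).2 h1
      have hti : t i = c i / c j := by simp [t, hij]
      rw [hx'] at h2
      simp only [map_sub, map_smul, hti] at h2
      rw [sub_eq_zero.1 h2, Algebra.smul_def]
      simp only [η]
      rw [← mul_assoc, ← map_mul, div_eq_mul_inv]
  have hmapY : Ideal.map π (Ideal.span (x '' Y)) ≤ Ideal.span {η} := by
    rw [Ideal.map_span, Ideal.span_le]
    rintro _ ⟨_, ⟨i, hi, rfl⟩, rfl⟩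
    rw [hπx ⟨i, hi⟩]
    exact Ideal.mul_mem_left _ _ (Ideal.mem_span_singleton_self η)
  have hηb : η ^ b = 0 := by
    have h1 := Ideal.mem_map_of_mem π haq
    rw [Ideal.map_pow] at h1
    have h2 := Ideal.pow_right_mono hmapY _ h1
    rw [Ideal.span_singleton_pow, Ideal.mem_span_singleton] at h2
    obtain ⟨z, hz⟩ := h2
    have hπa : π a = 0 := (hπ0 _).2 (Ideal.mem_sup_left haP)
    have hev : π (MvPolynomial.aeval (fun i : Y => x i) q) =
        algebraMap K S (MvPolynomial.eval c q) * η ^ b := by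
      rw [← aeval_smul_homog q b hqh c η, MvPolynomial.comp_aeval_apply]
      congr 2
      ext i; exact hπx i
    rw [map_sub, hπa, hev, zero_sub] at hz
    obtain ⟨z', rfl⟩ := Ideal.Quotient.mk_surjective z
    change _ = _ * π z' at hz
    have hu : IsUnit (algebraMap K R (MvPolynomial.eval c q) +
        algebraMap K R (c j)⁻¹ * x j * z') := by
      by_contra hcon
      have h3 := (mem_maximalIdeal _).2 hcon
      have h4 : algebraMap K R (c j)⁻¹ * x j * z' ∈ maximalIdeal R :=
        Ideal.mul_mem_right _ _ (Ideal.mul_mem_left _ _ (hxm j))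
      have h5 := sub_mem h3 h4
      rw [add_sub_cancel_right] at h5
      exact (mem_maximalIdeal _).1 h5 ((IsUnit.mk0 _ hc).map _)
    have hu' := hu.map π
    refine (hu'.mul_left_eq_zero).1 ?_
    rw [map_add, map_mul, map_mul, AlgHom.commutes, AlgHom.commutes]
    change η ^ b * (_ + η * _) = 0
    rw [pow_succ] at hz
    linear_combination -hz
  have hmap : Ideal.map π (maximalIdeal R ^ (m * b)) ≤ ⊥ := by
    rw [pow_mul, Ideal.map_pow]
    have h1 : Ideal.map π (maximalIdeal R ^ m) ≤ Ideal.span {η} := by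
      refine (Ideal.map_mono hm).trans ?_
      rw [Ideal.map_sup]
      refine sup_le ?_ hmapY
      rw [Ideal.map_le_iff_le_comap]
      intro r hr
      rw [Ideal.mem_comap, (hπ0 r).2 (Ideal.mem_sup_left hr)]
      exact zero_mem _
    refine (Ideal.pow_right_mono h1 b).trans ?_
    rw [Ideal.span_singleton_pow, hηb]; simp
  intro r hr
  exact (hπ0 r).1 (by simpa using hmap (Ideal.mem_map_of_mem π hr))

end noether2

section noether3
open IsLocalRing

variable {K R : Type} [Field K] [CommRing R] [Algebra K R]
  {ι : Type} [Fintype ι] [DecidableEq ι]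

lemma sup_pow_le_pow_sup {R : Type*} [CommRing R] (I J : Ideal R) (n : ℕ) :
    (I ⊔ J) ^ n ≤ I ^ n ⊔ J := by
  induction n with
  | zero => simp
  | succ n ih =>
    intro z hz
    rw [pow_succ] at hz
    refine Submodule.mul_induction_on hz ?_ (fun a b ha hb => add_mem ha hb)
    intro a ha b hb
    obtain ⟨p, hp, q, hq, rfl⟩ := Submodule.mem_sup.1 (ih ha)
    obtain ⟨p', hp', q', hq', rfl⟩ := Submodule.mem_sup.1 hb
    have h1 : p * p' ∈ I ^ (n + 1) := by rw [pow_succ]; exact Ideal.mul_mem_mul hp hp'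
    have h2 : p * q' + q * (p' + q') ∈ J :=
      add_mem (Ideal.mul_mem_left _ _ hq') (Ideal.mul_mem_right _ _ hq)
    have := add_mem (Ideal.mem_sup_left (T := J) h1) (Ideal.mem_sup_right h2)
    convert this using 1; ring

lemma approx_step {R K : Type} [Field K] [CommRing R] [Algebra K R] [IsLocalRing R] {ι : Type}
    [Finite ι]
    (hres : ∀ r : R, ∃ c : K, r - algebraMap K R c ∈ maximalIdeal R)
    (x : ι → R) (hx : Ideal.span (Set.range x) = maximalIdeal R) (k : ℕ) :
    ∃ B : Submodule K R, B.FG ∧ B ≤ Subalgebra.toSubmodule (Algebra.adjoin K (Set.range x)) ∧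
      ∀ r ∈ maximalIdeal R ^ k, ∃ r' ∈ B, r - r' ∈ maximalIdeal R ^ (k + 1) := by
  have hxm : ∀ i, x i ∈ maximalIdeal R := fun i => by
    rw [← hx]; exact Ideal.subset_span ⟨i, rfl⟩
  induction k with
  | zero =>
    refine ⟨Submodule.span K {1}, Submodule.fg_span_singleton _, ?_, ?_⟩
    · rw [Submodule.span_le]
      rintro _ rfl
      exact one_mem (Algebra.adjoin K (Set.range x))
    · intro r _
      obtain ⟨c, hc⟩ := hres r
      exact ⟨algebraMap K R c, Submodule.mem_span_singleton.2 ⟨c, by rw [Algebra.smul_def, mul_one]⟩,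
        by simpa using hc⟩
  | succ k ih =>
    obtain ⟨B, hB, hBA, hBr⟩ := ih
    refine ⟨B * Submodule.span K (Set.range x), hB.mul (Submodule.fg_span (Set.finite_range x)),
      ?_, ?_⟩
    · rw [Submodule.mul_le]
      intro a ha b hb
      refine mul_mem (S := Subalgebra K R) (hBA ha) ?_
      exact (Submodule.span_le (p := Subalgebra.toSubmodule (Algebra.adjoin K (Set.range x)))).2
        (Algebra.subset_adjoin (R := K) (s := Set.range x)) hb
    · intro r hr
      rw [pow_succ] at hr
      refine Submodule.mul_induction_on hr ?_ ?_
      · intro a ha b hb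
        rw [← hx] at hb
        induction hb using Submodule.span_induction generalizing a with
        | mem y hy =>
          obtain ⟨i, rfl⟩ := hy
          obtain ⟨a', ha', haa⟩ := hBr a ha
          refine ⟨a' * x i, Submodule.mul_mem_mul ha' (Submodule.subset_span ⟨i, rfl⟩), ?_⟩
          rw [← sub_mul, pow_succ]
          exact Ideal.mul_mem_mul haa (hxm i)
        | zero => exact ⟨0, zero_mem _, by simp⟩
        | add y z _ _ hy hz =>
          obtain ⟨y', hy', hyy⟩ := hy a ha
          obtain ⟨z', hz', hzz⟩ := hz a ha
          refine ⟨y' + z', add_mem hy' hz', ?_⟩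
          have := add_mem hyy hzz
          convert this using 1; ring
        | smul c y _ hy =>
          obtain ⟨y', hy', hyy⟩ := hy (a * c) (Ideal.mul_mem_right _ _ ha)
          refine ⟨y', hy', ?_⟩
          rwa [smul_eq_mul, ← mul_assoc]
      · rintro y z ⟨y', hy', hyy⟩ ⟨z', hz', hzz⟩
        refine ⟨y' + z', add_mem hy' hz', ?_⟩
        have := add_mem hyy hzz
        convert this using 1; ring

lemma approx_poly {R K : Type} [Field K] [CommRing R] [Algebra K R] [IsLocalRing R] {ι : Type}
    [Finite ι]
    (hres : ∀ r : R, ∃ c : K, r - algebraMap K R c ∈ maximalIdeal R)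
    (x : ι → R) (hx : Ideal.span (Set.range x) = maximalIdeal R) (L : ℕ) :
    ∃ B : Submodule K R, B.FG ∧ B ≤ Subalgebra.toSubmodule (Algebra.adjoin K (Set.range x)) ∧
      ∀ r, ∃ r' ∈ B, r - r' ∈ maximalIdeal R ^ L := by
  induction L with
  | zero => exact ⟨⊥, Submodule.fg_bot, bot_le, fun r => ⟨0, zero_mem _, by simp⟩⟩
  | succ L ih =>
    obtain ⟨B, hB, hBA, hBr⟩ := ih
    obtain ⟨B', hB', hBA', hBr'⟩ := approx_step hres x hx L
    refine ⟨B ⊔ B', hB.sup hB', sup_le hBA hBA', fun r => ?_⟩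
    obtain ⟨a, ha, har⟩ := hBr r
    obtain ⟨b, hb, hbr⟩ := hBr' _ har
    exact ⟨a + b, add_mem (Submodule.mem_sup_left ha) (Submodule.mem_sup_right hb),
      by rwa [← sub_sub]⟩

lemma serA_gen [IsNoetherianRing R] [IsLocalRing R] [IsAdicComplete (maximalIdeal R) R]
    (hres : ∀ r : R, ∃ c : K, r - algebraMap K R c ∈ maximalIdeal R) {x : ι → R}
    {D : ι → Derivation K R R} (h : IsCoord x D) (Y : Finset ι) (P : Ideal R)
    (m : ℕ) (hm : maximalIdeal R ^ m ≤ P ⊔ Ideal.span (x '' Y)) (M : ℕ) (r : R) :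
    ∃ q ∈ Subring.closure ((serA K x Y : Set R) ∪ Set.range x), r - q ∈ P ^ M := by
  set J := Ideal.span (x '' (Y : Set ι)) with hJ
  have hle : J ≤ maximalIdeal R := by
    rw [← h.2]; exact Ideal.span_mono (Set.image_subset_range _ _)
  obtain ⟨B, ⟨b, hb⟩, hBA, hBr⟩ := approx_poly hres x h.2 (m * M)
  have hKA : ∀ c : K, algebraMap K R c ∈ serA K x Y := fun c T => ⟨MvPolynomial.C c, by simp⟩
  have hbcl : ∀ β ∈ b, β ∈ Subring.closure ((serA K x Y : Set R) ∪ Set.range x) := by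
    intro β hβ
    have h1 : β ∈ Algebra.adjoin K (Set.range x) := hBA (by rw [← hb]; exact Submodule.subset_span hβ)
    clear hβ
    induction h1 using Algebra.adjoin_induction with
    | mem y hy => exact Subring.subset_closure (Or.inr hy)
    | algebraMap c => exact Subring.subset_closure (Or.inl (hKA c))
    | add y z _ _ hy hz => exact add_mem hy hz
    | mul y z _ _ hy hz => exact mul_mem hy hz
  let H : ℕ → Set R := fun T => {v | v ∈ J ^ T ∧
    ∃ Q : MvPolynomial Y K, MvPolynomial.aeval (fun i : Y => x i) Q = v}
  have Hadd : ∀ T v w, v ∈ H T → w ∈ H T → v + w ∈ H T := by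
    rintro T v w ⟨hv, Q, rfl⟩ ⟨hw, Q', rfl⟩
    exact ⟨add_mem hv hw, Q + Q', map_add _ _ _⟩
  have H0 : ∀ T, (0 : R) ∈ H T := fun T => ⟨zero_mem _, 0, map_zero _⟩
  let Good : ℕ → R → Prop := fun T r => ∃ u : R → R, (∀ β, u β ∈ H T) ∧
    r - ∑ β ∈ b, u β * β ∈ J ^ (T + 1) ⊔ P ^ M
  have Good_add : ∀ T y z, Good T y → Good T z → Good T (y + z) := by
    rintro T y z ⟨u, hu, hy⟩ ⟨v, hv, hz⟩
    refine ⟨fun β => u β + v β, fun β => Hadd _ _ _ (hu β) (hv β), ?_⟩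
    have := add_mem hy hz
    convert this using 1
    simp only [add_mul, Finset.sum_add_distrib]; ring
  have Good_P : ∀ T, ∀ z ∈ P ^ M, Good T z := fun T z hz =>
    ⟨fun _ => 0, fun _ => H0 T, by simpa using Ideal.mem_sup_right hz⟩
  have Good_J : ∀ T, ∀ z ∈ J ^ T, Good T z := by
    intro T
    induction T with
    | zero =>
      intro z _
      obtain ⟨z', hz', hzz⟩ := hBr z
      rw [← hb] at hz'
      obtain ⟨c, -, hc⟩ := Submodule.mem_span_finset.1 hz'
      refine ⟨fun β => algebraMap K R (c β), fun β => ⟨by simp, MvPolynomial.C (c β), by simp⟩, ?_⟩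
      simp only [← Algebra.smul_def, hc]
      rw [pow_mul] at hzz
      have := sup_pow_le_pow_sup P J M (Ideal.pow_right_mono hm M hzz)
      rw [sup_comm]; simpa using this
    | succ T ih =>
      intro z hz
      rw [pow_succ] at hz
      refine Submodule.mul_induction_on hz ?_ (Good_add _)
      intro a ha y hy
      induction hy using Submodule.span_induction generalizing a with
      | mem y hy =>
        obtain ⟨i, hi, rfl⟩ := hy
        obtain ⟨u, hu, hua⟩ := ih a ha
        refine ⟨fun β => u β * x i, fun β => ?_, ?_⟩
        · obtain ⟨h1, Q, hQ⟩ := hu β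
          refine ⟨?_, Q * MvPolynomial.X ⟨i, hi⟩, by simp [hQ]⟩
          rw [pow_succ]
          exact Ideal.mul_mem_mul h1 (Ideal.subset_span ⟨i, hi, rfl⟩)
        · have : a * x i - ∑ β ∈ b, u β * x i * β = (a - ∑ β ∈ b, u β * β) * x i := by
            rw [sub_mul, Finset.sum_mul]
            congr 1
            exact Finset.sum_congr rfl fun β _ => by ring
          rw [this]
          obtain ⟨j, hj, p, hp, hjp⟩ := Submodule.mem_sup.1 hua
          rw [← hjp, add_mul]
          refine add_mem (Ideal.mem_sup_left ?_) (Ideal.mem_sup_right (Ideal.mul_mem_right _ _ hp))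
          rw [pow_succ _ (T + 1)]
          exact Ideal.mul_mem_mul hj (Ideal.subset_span ⟨i, hi, rfl⟩)
      | zero => rw [mul_zero]; exact Good_P _ 0 (zero_mem _)
      | add y z _ _ hy hz => rw [mul_add]; exact Good_add _ _ _ (hy a ha) (hz a ha)
      | smul c y _ hy =>
        rw [smul_eq_mul, ← mul_assoc]
        exact hy _ (Ideal.mul_mem_right _ _ ha)
  have Good_all : ∀ T z, z ∈ J ^ T ⊔ P ^ M → Good T z := by
    intro T z hz
    obtain ⟨j, hj, p, hp, rfl⟩ := Submodule.mem_sup.1 hz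
    exact Good_add _ _ _ (Good_J T j hj) (Good_P T p hp)
  choose! u hu hur using Good_all
  let ρ : ℕ → R := fun T => Nat.rec r (fun T z => z - ∑ β ∈ b, u T z β * β) T
  have hρs : ∀ T, ρ (T + 1) = ρ T - ∑ β ∈ b, u T (ρ T) β * β := fun T => rfl
  have hρ : ∀ T, ρ T ∈ J ^ T ⊔ P ^ M := by
    intro T
    induction T with
    | zero => simp
    | succ T ih => rw [hρs]; exact hur T _ ih
  let v : ℕ → R → R := fun T β => u T (ρ T) β
  have hv : ∀ T β, v T β ∈ H T := fun T β => hu T _ (hρ T) β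
  have hρsum : ∀ T, ρ T = r - ∑ β ∈ b, (∑ i ∈ Finset.range T, v i β) * β := by
    intro T
    induction T with
    | zero => simp [ρ]
    | succ T ih =>
      rw [hρs, ih]
      simp only [Finset.sum_range_succ, add_mul, Finset.sum_add_distrib, v]
      rw [ih]; ring
  have hsum := fun β => adic_sum (fun i => v i β) (fun i => Ideal.pow_right_mono hle i (hv i β).1)
  choose a ha using hsum
  have haJ : ∀ β T, a β - ∑ i ∈ Finset.range T, v i β ∈ J ^ T := by
    intro β T
    refine krull_closed _ _ fun S => ?_
    have h1 := Ideal.pow_le_pow_right (I := maximalIdeal R) (show S ≤ T + S by omega) (ha β (T + S))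
    have h2 : ∑ i ∈ Finset.range S, v (T + i) β ∈ J ^ T := sum_mem fun i _ =>
      Ideal.pow_le_pow_right (by omega) (hv (T + i) β).1
    have := add_mem (Ideal.mem_sup_left (T := maximalIdeal R ^ S) h2) (Ideal.mem_sup_right h1)
    convert this using 1
    rw [Finset.sum_range_add]; ring
  have haA : ∀ β, a β ∈ serA K x Y := by
    intro β T
    choose Q hQ using fun i => (hv i β).2
    refine ⟨∑ i ∈ Finset.range T, Q i, ?_⟩
    rw [map_sum]; simp only [hQ]
    exact haJ β T
  refine ⟨∑ β ∈ b, a β * β, sum_mem fun β hβ =>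
    mul_mem (Subring.subset_closure (Or.inl (haA β))) (hbcl β hβ), ?_⟩
  refine krull_closed _ _ fun S => ?_
  have h1 : J ^ S ≤ P ^ M ⊔ maximalIdeal R ^ S := (Ideal.pow_right_mono hle S).trans le_sup_right
  have h2 : ρ S ∈ P ^ M ⊔ maximalIdeal R ^ S := (sup_le h1 le_sup_left) (hρ S)
  have h3 : ∑ β ∈ b, (a β - ∑ i ∈ Finset.range S, v i β) * β ∈ P ^ M ⊔ maximalIdeal R ^ S :=
    sum_mem fun β _ => Ideal.mul_mem_right _ _ (h1 (haJ β S))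
  have := sub_mem h2 h3
  rw [hρsum] at this
  convert this using 1
  simp only [sub_mul, Finset.sum_sub_distrib]; ring

lemma noether_normal [Infinite K] [IsNoetherianRing R] [IsLocalRing R]
    [IsAdicComplete (maximalIdeal R) R]
    (hres : ∀ r : R, ∃ c : K, r - algebraMap K R c ∈ maximalIdeal R)
    (P : Ideal R) (hP : P ≤ maximalIdeal R) (N : ℕ) :
    ∀ (x : ι → R) (D : ι → Derivation K R R), IsCoord x D → ∀ (Y : Finset ι), Y.card = N →
      ∀ m, maximalIdeal R ^ m ≤ P ⊔ Ideal.span (x '' Y) →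
    ∃ (x : ι → R) (D : ι → Derivation K R R) (A : Subring R), IsCoord x D ∧
      (∀ a ∈ A, a ∈ P → a = 0) ∧ (∀ j, x j ∈ A ∨ ∀ a ∈ A, D j a = 0) ∧
      ∀ M r, ∃ q ∈ Subring.closure ((A : Set R) ∪ Set.range x), r - q ∈ P ^ M := by
  induction N using Nat.strong_induction_on with
  | _ N ih =>
    intro x D h Y hY m hm
    by_cases hA : ∀ a ∈ serA K x Y, a ∈ P → a = 0
    · refine ⟨x, D, serA K x Y, h, hA, fun j => ?_, serA_gen hres h Y P m hm⟩
      by_cases hj : j ∈ Y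
      · exact Or.inl (mem_serA_coord x Y j hj)
      · exact Or.inr (deriv_serA h Y j hj)
    · push Not at hA
      obtain ⟨a, ha, haP, ha0⟩ := hA
      obtain ⟨x', D', h', Y', hc, m', hm'⟩ := serA_drop h Y P hP m hm a ha haP ha0
      exact ih Y'.card (hY ▸ hc) x' D' h' Y' rfl m' hm'

end noether3

section formal
open IsLocalRing

lemma mvps_mem_span_X {n : ℕ} (F : MvPowerSeries (Fin n) ℝ)
    (hF : MvPowerSeries.constantCoeff F = 0) :
    F ∈ Ideal.span (Set.range (MvPowerSeries.X : Fin n → MvPowerSeries (Fin n) ℝ)) := by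
  classical
  by_cases hn : Nonempty (Fin n)
  swap
  · have hne : IsEmpty (Fin n) := not_nonempty_iff.1 hn
    have : F = 0 := by
      ext d
      have hd : d = 0 := Subsingleton.elim _ _
      rw [hd, MvPowerSeries.coeff_zero_eq_constantCoeff, hF]; simp
    rw [this]; exact Ideal.zero_mem _
  have hi : ∀ d : Fin n →₀ ℕ, ∃ i, d ≠ 0 → d i ≠ 0 := by
    intro d
    by_cases hd : d = 0
    · exact ⟨hn.some, fun h => absurd hd h⟩
    · obtain ⟨i, hi⟩ := Finsupp.ne_iff.1 hd
      exact ⟨i, fun _ => hi⟩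
  choose c hc using hi
  let G : Fin n → MvPowerSeries (Fin n) ℝ := fun i e =>
    if c (e + Finsupp.single i 1) = i then MvPowerSeries.coeff (e + Finsupp.single i 1) F else 0
  have hG : ∀ i e, MvPowerSeries.coeff e (G i) = if c (e + Finsupp.single i 1) = i then
      MvPowerSeries.coeff (e + Finsupp.single i 1) F else 0 := fun i e => rfl
  have : F = ∑ i, MvPowerSeries.X i * G i := by
    ext d
    rw [map_sum]
    have h1 : ∀ i, MvPowerSeries.coeff d (MvPowerSeries.X i * G i) =
        if Finsupp.single i 1 ≤ d then (if c d = i then MvPowerSeries.coeff d F else 0) else 0 := by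
      intro i
      rw [MvPowerSeries.X, MvPowerSeries.coeff_monomial_mul]
      split_ifs with h h' h'
      · rw [one_mul, hG, tsub_add_cancel_of_le h, if_pos h']
      · rw [one_mul, hG, tsub_add_cancel_of_le h, if_neg h']
      · rfl
    simp_rw [h1]
    by_cases hd : d = 0
    · subst hd
      rw [MvPowerSeries.coeff_zero_eq_constantCoeff, hF]
      simp
    · have h2 : Finsupp.single (c d) 1 ≤ d := by
        rw [Finsupp.single_le_iff]
        exact Nat.one_le_iff_ne_zero.2 (hc d hd)
      rw [Finset.sum_eq_single (c d)]
      · simp [h2]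
      · intro b _ hb
        simp [Ne.symm hb]
      · simp
  rw [this]
  exact Ideal.sum_mem _ fun i _ => Ideal.mul_mem_right _ _ (Ideal.subset_span ⟨i, rfl⟩)

lemma mvps_max {n : ℕ} :
    Ideal.span (Set.range (MvPowerSeries.X : Fin n → MvPowerSeries (Fin n) ℝ)) =
      maximalIdeal (MvPowerSeries (Fin n) ℝ) := by
  apply le_antisymm
  · rw [Ideal.span_le]
    rintro _ ⟨i, rfl⟩
    rw [SetLike.mem_coe, mem_maximalIdeal, mem_nonunits_iff, MvPowerSeries.isUnit_iff_constantCoeff]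
    simp
  · intro F hF
    rw [mem_maximalIdeal, mem_nonunits_iff, MvPowerSeries.isUnit_iff_constantCoeff] at hF
    apply mvps_mem_span_X
    simpa using hF

/-- Every derivation of the power series ring is a combination of the partial derivatives. -/
lemma mvps_derivation {n : ℕ}
    (E : Derivation ℝ (MvPowerSeries (Fin n) ℝ) (MvPowerSeries (Fin n) ℝ))
    (r : MvPowerSeries (Fin n) ℝ) :
    E r = ∑ j, E (MvPowerSeries.X j) * MvPowerSeries.pderiv ℝ j r := by
  classical
  let E' : Derivation ℝ (MvPowerSeries (Fin n) ℝ) (MvPowerSeries (Fin n) ℝ) :=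
    E - ∑ j, E (MvPowerSeries.X j) • MvPowerSeries.pderiv ℝ j
  have hE' : ∀ r, E' r = E r - ∑ j, E (MvPowerSeries.X j) * MvPowerSeries.pderiv ℝ j r := by
    intro r
    have : (∑ j, E (MvPowerSeries.X j) • MvPowerSeries.pderiv ℝ j) r =
      ∑ j, E (MvPowerSeries.X j) * MvPowerSeries.pderiv ℝ j r := by
      rw [← Derivation.coeFnAddMonoidHom_apply, map_sum, Finset.sum_apply]
      rfl
    rw [← this]; rfl
  have hX : ∀ i, E' (MvPowerSeries.X i) = 0 := by
    intro i
    rw [hE', sub_eq_zero, Finset.sum_eq_single i]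
    · simp
    · intro b _ hb
      rw [MvPowerSeries.pderiv_X_of_ne (Ne.symm hb), mul_zero]
    · simp
  have hC : ∀ c : ℝ, E' (MvPowerSeries.C c) = 0 := fun c => E'.map_algebraMap c
  have hres : ∀ r : MvPowerSeries (Fin n) ℝ, r - MvPowerSeries.C (MvPowerSeries.constantCoeff r) ∈
      Ideal.span (Set.range (MvPowerSeries.X : Fin n → MvPowerSeries (Fin n) ℝ)) := by
    intro r
    apply mvps_mem_span_X
    simp
  have key : ∀ T : ℕ, ∀ r, E' r ∈
      (Ideal.span (Set.range (MvPowerSeries.X : Fin n → MvPowerSeries (Fin n) ℝ))) ^ T := by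
    intro T
    induction T with
    | zero => simp
    | succ T ih =>
      intro r
      have h1 := hres r
      obtain ⟨c, hc⟩ := (Ideal.mem_span_range_iff_exists_fun).1 h1
      have h2 : r = MvPowerSeries.C (MvPowerSeries.constantCoeff r) +
        ∑ i, c i * MvPowerSeries.X i := by rw [hc]; ring
      rw [h2, map_add, hC, zero_add, map_sum]
      refine Ideal.sum_mem _ fun i _ => ?_
      rw [Derivation.leibniz, hX, smul_zero, zero_add, smul_eq_mul, pow_succ']
      exact Ideal.mul_mem_mul (Ideal.subset_span ⟨i, rfl⟩) (ih _)
  have hz : E' r = 0 := by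
    have hH : IsHausdorff (Ideal.span (Set.range
      (MvPowerSeries.X : Fin n → MvPowerSeries (Fin n) ℝ))) (MvPowerSeries (Fin n) ℝ) :=
      inferInstance
    apply hH.haus'
    intro S
    rw [SModEq.zero]
    simpa using key S r
  rw [hE', sub_eq_zero] at hz
  exact hz

theorem formal_lojasiewicz {n : ℕ} (F : MvPowerSeries (Fin n) ℝ) :
    ∃ N : ℕ, F ^ N ∈ (Ideal.span (insert F
      (Set.range fun i => MvPowerSeries.pderiv ℝ i F))) ^ (N + 1) := by
  classical
  by_cases hF : F = 0
  · exact ⟨1, by rw [hF]; simp⟩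
  by_contra hcon
  push Not at hcon
  have hdom : IsDomain (MvPowerSeries (Fin n) ℝ) := NoZeroDivisors.to_isDomain _
  obtain ⟨V, hV, hRV, hFV, hgV⟩ := exists_dvr (FractionRing (MvPowerSeries (Fin n) ℝ)) F hF
    (fun i => MvPowerSeries.pderiv ℝ i F) hcon
  let φ : MvPowerSeries (Fin n) ℝ →+* V :=
    (algebraMap (MvPowerSeries (Fin n) ℝ) (FractionRing (MvPowerSeries (Fin n) ℝ))).codRestrict
      V.toSubring hRV
  have hφ : ∀ r, ((φ r : V) : FractionRing (MvPowerSeries (Fin n) ℝ)) =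
    algebraMap (MvPowerSeries (Fin n) ℝ) _ r := fun r => rfl
  have hch : CharZero (ResidueField V) :=
    charZero_of_injective_ringHom (f := (residue V).comp (φ.comp
      (algebraMap ℝ (MvPowerSeries (Fin n) ℝ)))) (RingHom.injective _)
  have hac : IsAdicComplete (maximalIdeal (MvPowerSeries (Fin n) ℝ)) (MvPowerSeries (Fin n) ℝ) := by
    rw [← mvps_max]; infer_instance
  have hP : (maximalIdeal V).comap φ ≤ maximalIdeal (MvPowerSeries (Fin n) ℝ) := by
    apply le_maximalIdeal
    exact Ideal.IsPrime.ne_top'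
  obtain ⟨x, D, A, hco, hAP, hAx, hgen⟩ := noether_normal (K := ℝ)
    (R := MvPowerSeries (Fin n) ℝ) (ι := Fin n)
    (fun r => ⟨MvPowerSeries.constantCoeff r, by
      rw [← mvps_max]
      apply mvps_mem_span_X
      change MvPowerSeries.constantCoeff (r - MvPowerSeries.C _) = 0
      simp⟩)
    ((maximalIdeal V).comap φ) hP (Finset.univ : Finset (Fin n)).card
    MvPowerSeries.X (MvPowerSeries.pderiv ℝ)
    ⟨fun i j => by
      by_cases h : i = j
      · subst h; simp
      · rw [MvPowerSeries.pderiv_X_of_ne (Ne.symm h), if_neg h], mvps_max⟩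
    Finset.univ rfl 1 (by
      rw [pow_one, Finset.coe_univ, Set.image_univ, mvps_max]; exact le_sup_right)
  have hdvd0 : ∀ i, φ F ∣ φ (MvPowerSeries.pderiv ℝ i F) := by
    intro i
    obtain ⟨a, ha⟩ := (V.valuation_le_iff _ _).1 (hgV i)
    refine ⟨a, ?_⟩
    apply Subtype.ext
    rw [mul_comm]
    exact ha.symm
  refine core_contradiction φ F (fun i => (D i : _ → _)) (fun i a b => map_add _ _ _)
    (fun i a b => by rw [Derivation.leibniz]; rfl) x hco.1 A ?_ hAx hgen ?_ ?_ ?_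
  · intro a ha ha0
    by_contra hu
    exact ha0 (hAP a ha (by rw [Ideal.mem_comap, mem_maximalIdeal]; exact hu))
  · intro h0
    apply hF
    have h1 := hφ F
    rw [h0] at h1
    exact (FaithfulSMul.algebraMap_injective _ _) (by rw [← h1, map_zero]; rfl)
  · rw [← mem_nonunits_iff, ← mem_maximalIdeal]
    exact (V.valuation_lt_one_iff _).2 hFV
  · intro i
    rw [mvps_derivation (D i) F, map_sum]
    refine Finset.dvd_sum fun j _ => ?_
    rw [map_mul]
    exact Dvd.dvd.mul_left (hdvd0 j) _

end formal

section transfer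
open Asymptotics Topology

/-- The evaluation of a polynomial at a point of Euclidean space. -/
noncomputable def pev {n : ℕ} (Q : MvPolynomial (Fin n) ℝ) (y : EuclideanSpace ℝ (Fin n)) : ℝ :=
  MvPolynomial.eval (fun i => y i) Q

lemma pev_isBigO {n : ℕ} (M : ℕ) (Q : MvPolynomial (Fin n) ℝ)
    (hQ : ∀ d, d.degree < M → Q.coeff d = 0) :
    (pev Q) =O[𝓝 0] (fun y => ‖y‖ ^ M) := by
  have h1 : pev Q = fun y => ∑ d ∈ Q.support, Q.coeff d * ∏ i, y i ^ d i := by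
    funext y
    exact MvPolynomial.eval_eq' _ _
  rw [h1]
  apply IsBigO.fun_sum
  intro d hd
  have hd' : M ≤ d.degree := by
    by_contra h
    push Not at h
    exact (MvPolynomial.mem_support_iff.1 hd) (hQ d h)
  apply IsBigO.const_mul_left
  have hb : ∀ᶠ y : EuclideanSpace ℝ (Fin n) in 𝓝 0, ‖y‖ < 1 := by
    have := Metric.ball_mem_nhds (0 : EuclideanSpace ℝ (Fin n)) one_pos
    filter_upwards [this] with y hy
    simpa using hy
  apply IsBigO.of_bound 1
  filter_upwards [hb] with y hy
  rw [norm_prod, one_mul, norm_pow, norm_norm]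
  calc ∏ i, ‖y i ^ d i‖ ≤ ∏ i, ‖y‖ ^ d i := by
        apply Finset.prod_le_prod
        · intros; positivity
        · intro i _
          rw [norm_pow]
          exact pow_le_pow_left₀ (norm_nonneg _) (PiLp.norm_apply_le y i) _
    _ = ‖y‖ ^ d.degree := by
        rw [Finset.prod_pow_eq_pow_sum, Finsupp.degree_eq_sum]
    _ ≤ ‖y‖ ^ M := pow_le_pow_of_le_one (norm_nonneg _) hy.le hd'

lemma pev_continuous {n : ℕ} (Q : MvPolynomial (Fin n) ℝ) : Continuous (pev Q) := by
  have h1 : pev Q = fun y => ∑ d ∈ Q.support, Q.coeff d * ∏ i, y i ^ d i := by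
    funext y
    exact MvPolynomial.eval_eq' _ _
  rw [h1]
  fun_prop

/-- `g` agrees with the power series `A` to order `M`. -/
def Appr {n : ℕ} (M : ℕ) (A : MvPowerSeries (Fin n) ℝ) (g : EuclideanSpace ℝ (Fin n) → ℝ) : Prop :=
  ∃ Q : MvPolynomial (Fin n) ℝ, (∀ d, d.degree < M → Q.coeff d = MvPowerSeries.coeff d A) ∧
    (fun y => g y - pev Q y) =O[𝓝 0] (fun y => ‖y‖ ^ M)

variable {n M : ℕ} {A B : MvPowerSeries (Fin n) ℝ} {g h : EuclideanSpace ℝ (Fin n) → ℝ}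

lemma Appr.ex (M : ℕ) (A : MvPowerSeries (Fin n) ℝ) : ∃ g, Appr M A g := by
  refine ⟨pev (MvPowerSeries.truncTotal M A), MvPowerSeries.truncTotal M A, ?_, ?_⟩
  · intro d hd
    exact MvPowerSeries.coeff_truncTotal _ hd
  · simp only [sub_self]
    exact isBigO_zero _ _

lemma norm_pow_isBigO_one (M : ℕ) : (fun y : EuclideanSpace ℝ (Fin n) => ‖y‖ ^ M) =O[𝓝 0]
    (fun _ => (1 : ℝ)) := by
  have h : Continuous (fun y : EuclideanSpace ℝ (Fin n) => ‖y‖ ^ M) := by fun_prop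
  exact (h.tendsto 0).isBigO_one ℝ

lemma pev_isBigO_one (Q : MvPolynomial (Fin n) ℝ) : pev Q =O[𝓝 0] (fun _ => (1 : ℝ)) :=
  ((pev_continuous Q).tendsto 0).isBigO_one ℝ

lemma Appr.isBigO_one (hg : Appr M A g) : g =O[𝓝 0] (fun _ => (1 : ℝ)) := by
  obtain ⟨Q, -, hQ⟩ := hg
  have h1 := (hQ.trans (norm_pow_isBigO_one M)).add
    (pev_isBigO_one Q)
  simpa using h1

lemma Appr.add (hg : Appr M A g) (hh : Appr M B h) : Appr M (A + B) (fun y => g y + h y) := by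
  obtain ⟨Q, hQ, hQ'⟩ := hg
  obtain ⟨S, hS, hS'⟩ := hh
  refine ⟨Q + S, ?_, ?_⟩
  · intro d hd
    rw [MvPolynomial.coeff_add, map_add, hQ d hd, hS d hd]
  · refine (hQ'.add hS').congr_left fun y => ?_
    simp only [pev, map_add]; ring

lemma Appr.mul (hg : Appr M A g) (hh : Appr M B h) : Appr M (A * B) (fun y => g y * h y) := by
  classical
  have hh1 := hh.isBigO_one
  obtain ⟨Q, hQ, hQ'⟩ := hg
  obtain ⟨S, hS, hS'⟩ := hh
  refine ⟨Q * S, ?_, ?_⟩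
  · intro d hd
    rw [MvPolynomial.coeff_mul, MvPowerSeries.coeff_mul]
    refine Finset.sum_congr rfl fun e he => ?_
    rw [Finset.HasAntidiagonal.mem_antidiagonal] at he
    have : e.1.degree + e.2.degree = d.degree := by rw [← he, map_add]
    rw [hQ _ (by omega), hS _ (by omega)]
  · have h1 := hQ'.mul hh1
    have h2 := (pev_isBigO_one Q).mul hS'
    simp only [mul_one] at h1
    simp only [one_mul] at h2
    refine (h1.add h2).congr_left fun y => ?_
    simp only [pev, map_mul]; ring

lemma Appr.one : Appr M (1 : MvPowerSeries (Fin n) ℝ) (fun _ => 1) := by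
  refine ⟨1, ?_, ?_⟩
  · intro d _
    classical
    rw [MvPolynomial.coeff_one, MvPowerSeries.coeff_one]
    simp [eq_comm]
  · simp only [pev, map_one, sub_self]
    exact isBigO_zero _ _

lemma Appr.pow (hg : Appr M A g) (N : ℕ) : Appr M (A ^ N) (fun y => g y ^ N) := by
  induction N with
  | zero => simpa using Appr.one
  | succ N ih => simpa only [pow_succ] using ih.mul hg

lemma Appr.zero : Appr M (0 : MvPowerSeries (Fin n) ℝ) (fun _ => 0) :=
  ⟨0, by simp, by simpa [pev] using isBigO_zero _ _⟩

lemma Appr.unique (hg : Appr M A g) (hh : Appr M A h) :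
    (fun y => g y - h y) =O[𝓝 0] (fun y => ‖y‖ ^ M) := by
  obtain ⟨Q, hQ, hQ'⟩ := hg
  obtain ⟨S, hS, hS'⟩ := hh
  have h1 : pev (Q - S) =O[𝓝 0] (fun y => ‖y‖ ^ M) := by
    apply pev_isBigO
    intro d hd
    rw [MvPolynomial.coeff_sub, hQ d hd, hS d hd, sub_self]
  refine ((hQ'.sub hS').add h1).congr_left fun y => ?_
  simp only [pev, map_sub]; ring

lemma Appr.ideal {S : Set (MvPowerSeries (Fin n) ℝ)} {φ : EuclideanSpace ℝ (Fin n) → ℝ}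
    (hS : ∀ s ∈ S, ∃ g, Appr M s g ∧ g =O[𝓝 0] φ) (k : ℕ) :
    ∀ A ∈ (Ideal.span S) ^ k, ∃ g, Appr M A g ∧ g =O[𝓝 0] (fun y => φ y ^ k) := by
  have hspan : ∀ A ∈ Ideal.span S, ∃ g, Appr M A g ∧ g =O[𝓝 0] φ := by
    intro A hA
    induction hA using Submodule.span_induction with
    | mem x hx => exact hS x hx
    | zero => exact ⟨_, Appr.zero, isBigO_zero _ _⟩
    | add x y _ _ hx hy =>
      obtain ⟨g, hg, hg'⟩ := hx
      obtain ⟨h, hh, hh'⟩ := hy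
      exact ⟨_, hg.add hh, hg'.add hh'⟩
    | smul a x _ hx =>
      obtain ⟨g, hg, hg'⟩ := hx
      obtain ⟨h, hh⟩ := Appr.ex M a
      refine ⟨_, hh.mul hg, ?_⟩
      simpa only [one_mul] using hh.isBigO_one.mul hg'
  induction k with
  | zero =>
    intro A _
    obtain ⟨g, hg⟩ := Appr.ex M A
    exact ⟨g, hg, by simpa using hg.isBigO_one⟩
  | succ k ih =>
    intro A hA
    rw [pow_succ] at hA
    refine Submodule.mul_induction_on hA ?_ ?_
    · intro a ha b hb
      obtain ⟨g, hg, hg'⟩ := ih a ha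
      obtain ⟨h, hh, hh'⟩ := hspan b hb
      refine ⟨_, hg.mul hh, ?_⟩
      simpa only [pow_succ] using hg'.mul hh'
    · rintro x y ⟨g, hg, hg'⟩ ⟨h, hh, hh'⟩
      exact ⟨_, hg.add hh, hg'.add hh'⟩

lemma Appr.transfer {ι : Type} [Fintype ι] (G : ι → MvPowerSeries (Fin n) ℝ)
    (dg : ι → EuclideanSpace ℝ (Fin n) → ℝ)
    (hA : Appr M A g) (hG : ∀ i, Appr M (G i) (dg i)) (N : ℕ)
    (hN : A ^ N ∈ (Ideal.span (insert A (Set.range G))) ^ (N + 1)) :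
    ∃ h : EuclideanSpace ℝ (Fin n) → ℝ,
      h =O[𝓝 0] (fun y => (|g y| + ∑ i, |dg i y|) ^ (N + 1)) ∧
      (fun y => g y ^ N - h y) =O[𝓝 0] (fun y => ‖y‖ ^ M) := by
  obtain ⟨h, hh, hh'⟩ := Appr.ideal (M := M) (φ := fun y => |g y| + ∑ i, |dg i y|) (by
    rintro s (rfl | ⟨i, rfl⟩)
    · refine ⟨g, hA, IsBigO.of_bound 1 (Filter.Eventually.of_forall fun y => ?_)⟩
      have : 0 ≤ ∑ i, |dg i y| := Finset.sum_nonneg fun _ _ => abs_nonneg _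
      rw [one_mul, Real.norm_eq_abs, Real.norm_eq_abs]
      exact le_trans (by linarith) (le_abs_self _)
    · refine ⟨dg i, hG i, IsBigO.of_bound 1 (Filter.Eventually.of_forall fun y => ?_)⟩
      have h1 : |dg i y| ≤ ∑ i, |dg i y| :=
        Finset.single_le_sum (f := fun i => |dg i y|) (fun _ _ => abs_nonneg _) (Finset.mem_univ i)
      rw [one_mul, Real.norm_eq_abs, Real.norm_eq_abs]
      exact le_trans (by linarith [abs_nonneg (g y)]) (le_abs_self _)) (N + 1) _ hN
  exact ⟨h, hh', (hA.pow N).unique hh⟩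

lemma pev_hasFDerivAt (Q : MvPolynomial (Fin n) ℝ) (y : EuclideanSpace ℝ (Fin n)) :
    ∃ L : EuclideanSpace ℝ (Fin n) →L[ℝ] ℝ, HasFDerivAt (pev Q) L y ∧
      ∀ i, L (EuclideanSpace.single i 1) = pev (MvPolynomial.pderiv i Q) y := by
  induction Q using MvPolynomial.induction_on with
  | C a =>
    refine ⟨0, ?_, by simp [pev]⟩
    have : pev (MvPolynomial.C a : MvPolynomial (Fin n) ℝ) = fun _ => a := by
      funext y; simp [pev]
    rw [this]; exact hasFDerivAt_const _ _
  | add p q hp hq =>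
    obtain ⟨L, hL, hL'⟩ := hp
    obtain ⟨L₂, hL₂, hL₂'⟩ := hq
    refine ⟨L + L₂, ?_, ?_⟩
    · have : pev (p + q) = fun y => pev p y + pev q y := by
        funext y; simp [pev]
      rw [this]; exact hL.add hL₂
    · intro i
      simp [hL', hL₂', pev]
  | mul_X p j hp =>
    classical
    obtain ⟨L, hL, hL'⟩ := hp
    have h2 : HasFDerivAt (fun y : EuclideanSpace ℝ (Fin n) => y j)
      (EuclideanSpace.proj j : EuclideanSpace ℝ (Fin n) →L[ℝ] ℝ) y :=
      (EuclideanSpace.proj j : EuclideanSpace ℝ (Fin n) →L[ℝ] ℝ).hasFDerivAt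
    refine ⟨pev p y • (EuclideanSpace.proj j : EuclideanSpace ℝ (Fin n) →L[ℝ] ℝ) + y j • L, ?_, ?_⟩
    · have : pev (p * MvPolynomial.X j) = fun y => pev p y * y j := by
        funext y; simp [pev]
      rw [this]; exact hL.mul h2
    · intro i
      have h3 : (EuclideanSpace.proj j : EuclideanSpace ℝ (Fin n) →L[ℝ] ℝ)
        (EuclideanSpace.single i 1) = if j = i then 1 else 0 := by simp
      rw [_root_.add_apply, _root_.smul_apply, _root_.smul_apply, hL', h3]
      by_cases h : j = i
      · subst h
        simp [pev, MvPolynomial.pderiv_X]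
      · simp [pev, MvPolynomial.pderiv_X, h]

end transfer

section taylor
open Asymptotics Topology

variable {n : ℕ}

/-- The homogeneous polynomial attached to a multilinear map. -/
noncomputable def mlPoly (m : ℕ)
    (q : ContinuousMultilinearMap ℝ (fun _ : Fin m => EuclideanSpace ℝ (Fin n)) ℝ) :
    MvPolynomial (Fin n) ℝ :=
  ∑ s : Fin m → Fin n, MvPolynomial.C (q (fun j => EuclideanSpace.single (s j) 1)) *
    ∏ j, MvPolynomial.X (s j)

lemma mlPoly_hom (m : ℕ)
    (q : ContinuousMultilinearMap ℝ (fun _ : Fin m => EuclideanSpace ℝ (Fin n)) ℝ) :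
    (mlPoly m q).IsHomogeneous m := by
  apply MvPolynomial.IsHomogeneous.sum
  intro s _
  have h1 : (∏ j : Fin m, (MvPolynomial.X (s j) : MvPolynomial (Fin n) ℝ)).IsHomogeneous
      (∑ j : Fin m, 1) :=
    MvPolynomial.IsHomogeneous.prod _ _ _ fun j _ => MvPolynomial.isHomogeneous_X _ _
  have h2 := (MvPolynomial.isHomogeneous_C (Fin n)
    (q (fun j => EuclideanSpace.single (s j) 1))).mul h1
  simpa using h2

lemma mlPoly_eval (m : ℕ)
    (q : ContinuousMultilinearMap ℝ (fun _ : Fin m => EuclideanSpace ℝ (Fin n)) ℝ)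
    (y : EuclideanSpace ℝ (Fin n)) : pev (mlPoly m q) y = q (fun _ => y) := by
  have hy : y = ∑ i, y i • (EuclideanSpace.single i (1 : ℝ) : EuclideanSpace ℝ (Fin n)) := by
    ext j
    simp [Finset.sum_apply, Pi.single_apply]
  have h1 : q (fun _ => y) = q (fun _ => ∑ i, y i • (EuclideanSpace.single i (1 : ℝ) :
      EuclideanSpace ℝ (Fin n))) := by rw [← hy]
  rw [h1, ContinuousMultilinearMap.map_sum]
  simp only [ContinuousMultilinearMap.map_smul_univ]
  simp only [pev, mlPoly, map_sum, map_mul, map_prod, MvPolynomial.eval_C, MvPolynomial.eval_X,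
    smul_eq_mul]
  exact Finset.sum_congr rfl fun s _ => mul_comm _ _

lemma exists_appr (g : EuclideanSpace ℝ (Fin n) → ℝ) (hg : AnalyticAt ℝ g 0) :
    ∃ F : MvPowerSeries (Fin n) ℝ, ∀ M, Appr M F g ∧
      ∀ i, Appr M (MvPowerSeries.pderiv ℝ i F)
        (fun y => fderiv ℝ g y (EuclideanSpace.single i 1)) := by
  classical
  obtain ⟨q, r, hq⟩ := hg
  let T : ℕ → MvPolynomial (Fin n) ℝ := fun M => ∑ m ∈ Finset.range M, mlPoly m (q m)
  let F : MvPowerSeries (Fin n) ℝ := fun d => (mlPoly d.degree (q d.degree)).coeff d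
  have hF : ∀ d, MvPowerSeries.coeff d F = (mlPoly d.degree (q d.degree)).coeff d := fun d => rfl
  have hT : ∀ M d, d.degree < M → (T M).coeff d = MvPowerSeries.coeff d F := by
    intro M d hd
    rw [hF, MvPolynomial.coeff_sum, Finset.sum_eq_single d.degree]
    · intro b _ hb
      exact (mlPoly_hom b (q b)).coeff_eq_zero (Ne.symm hb)
    · intro h
      exact absurd (Finset.mem_range.2 hd) h
  have hTe : ∀ M y, pev (T M) y = ∑ m ∈ Finset.range M, q m (fun _ => y) := by
    intro M y
    simp only [← mlPoly_eval]
    simp only [pev, T, map_sum]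
  let q' : ℕ → FormalMultilinearSeries ℝ (EuclideanSpace ℝ (Fin n)) ℝ :=
    fun M m => if m < M then 0 else q m
  have hq' : ∀ M, HasFPowerSeriesOnBall (fun y => g y - pev (T M) y) (q' M) 0 r := by
    intro M
    refine ⟨hq.r_le.trans (FormalMultilinearSeries.radius_le_of_le fun m => ?_), hq.r_pos, ?_⟩
    · simp only [q']
      split_ifs
      · rw [norm_zero]; exact norm_nonneg _
      · exact le_rfl
    · intro y hy
      have h1 := hq.hasSum hy
      have h2 : HasSum (fun m => if m < M then q m (fun _ => y) else 0) (pev (T M) (0 + y)) := by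
        have h3 := hasSum_sum_of_ne_finset_zero (L := .unconditional ℕ) (s := Finset.range M)
          (f := fun m => if m < M then q m (fun _ => y) else 0) (by
            intro b hb
            rw [if_neg (by simpa using hb)])
        convert! h3 using 1
        rw [zero_add, hTe]
        refine Finset.sum_congr rfl fun m hm => ?_
        rw [if_pos (Finset.mem_range.1 hm)]
      convert! h1.sub h2 using 1
      funext m
      simp only [q']
      split_ifs <;> simp
  have hO : ∀ M, (fun y => g y - pev (T M) y) =O[𝓝 0] (fun y => ‖y‖ ^ M) := by
    intro M
    have h1 := (hq' M).hasFPowerSeriesAt.isBigO_sub_partialSum_pow M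
    refine h1.congr_left fun y => ?_
    have : (q' M).partialSum M y = 0 := by
      rw [FormalMultilinearSeries.partialSum]
      refine Finset.sum_eq_zero fun m hm => ?_
      simp only [q', if_pos (Finset.mem_range.1 hm)]
      simp
    rw [this, sub_zero, zero_add]
  have hO' : ∀ M, (fun y => fderiv ℝ (fun y => g y - pev (T (M + 1)) y) y) =O[𝓝 0]
      (fun y => ‖y‖ ^ M) := by
    intro M
    have h1 := (hq' (M + 1)).fderiv.hasFPowerSeriesAt.isBigO_sub_partialSum_pow M
    refine h1.congr_left fun y => ?_
    have : (q' (M + 1)).derivSeries.partialSum M y = 0 := by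
      rw [FormalMultilinearSeries.partialSum]
      refine Finset.sum_eq_zero fun m hm => ?_
      rw [FormalMultilinearSeries.derivSeries_eq_zero]
      · rfl
      · simp only [q', if_pos (Nat.succ_lt_succ (Finset.mem_range.1 hm))]
    rw [this, sub_zero, zero_add]
  refine ⟨F, fun M => ⟨⟨T M, hT M, hO M⟩, fun i => ?_⟩⟩
  · refine ⟨MvPolynomial.pderiv i (T (M + 1)), ?_, ?_⟩
    · intro d hd
      rw [MvPolynomial.coeff_pderiv, MvPowerSeries.coeff_pderiv, hT]
      rw [map_add, Finsupp.degree_single]; omega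
    · have h1 : (fun y => (fderiv ℝ (fun y => g y - pev (T (M + 1)) y) y)
          (EuclideanSpace.single i 1)) =O[𝓝 0] (fun y => ‖y‖ ^ M) := by
        refine IsBigO.trans (IsBigO.of_bound ‖(EuclideanSpace.single i (1 : ℝ) :
          EuclideanSpace ℝ (Fin n))‖ (Filter.Eventually.of_forall fun y => ?_)) (hO' M)
        rw [mul_comm]
        exact ContinuousLinearMap.le_opNorm _ _
      refine h1.congr' ?_ (Filter.EventuallyEq.rfl)
      filter_upwards [hq.analyticAt.eventually_analyticAt] with y hy
      obtain ⟨L, hL, hL'⟩ := pev_hasFDerivAt (T (M + 1)) y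
      have h2 := (hy.differentiableAt.hasFDerivAt.sub hL).fderiv
      rw [← hL' i]
      have h3 : (fun y => g y - pev (T (M + 1)) y) = g - pev (T (M + 1)) := rfl
      rw [h3, h2]; rfl

end taylor

section gradineq
open Asymptotics Topology

lemma norm_gradient_eq {n : ℕ} (f : EuclideanSpace ℝ (Fin n) → ℝ) (x : EuclideanSpace ℝ (Fin n)) :
    ‖gradient f x‖ = ‖fderiv ℝ f x‖ := by
  rw [← toDual_gradient, LinearIsometryEquiv.norm_map]

lemma grad_ineq {n : ℕ} (f : EuclideanSpace ℝ (Fin n) → ℝ) (p : EuclideanSpace ℝ (Fin n))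
    (hf : AnalyticAt ℝ f p) :
    ∃ k₀ : ℕ, ∀ k : ℕ, k₀ ≤ k → 1 ≤ k ∧ ∀ᶠ x in 𝓝 p, x ≠ p → f x - f p = ‖x - p‖ ^ (2 * k) →
      2 * k * ‖x - p‖ ^ (2 * k - 1) < ‖gradient f x‖ := by
  set g : EuclideanSpace ℝ (Fin n) → ℝ := fun y => f (p + y) - f p with hgdef
  have hg : AnalyticAt ℝ g 0 := by
    have h1 : AnalyticAt ℝ f (p + 0) := by rwa [add_zero]
    have h2 : AnalyticAt ℝ (fun y : EuclideanSpace ℝ (Fin n) => p + y) 0 := by fun_prop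
    exact (AnalyticAt.fun_comp h1 h2).sub analyticAt_const
  have hfd : ∀ y, fderiv ℝ g y = fderiv ℝ f (p + y) := by
    intro y
    rw [hgdef, fderiv_sub_const, fderiv_comp_add_left]
  obtain ⟨F, hF⟩ := exists_appr g hg
  obtain ⟨N, hN⟩ := formal_lojasiewicz F
  refine ⟨N + 1, fun k hk => ⟨by omega, ?_⟩⟩
  obtain ⟨h, hh, hh'⟩ := Appr.transfer (fun i => MvPowerSeries.pderiv ℝ i F) _
    (hF (2 * k * N + 1)).1 (hF (2 * k * N + 1)).2 N hN
  obtain ⟨C₁, hC₁, hb₁⟩ := hh.exists_pos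
  obtain ⟨C₂, hC₂, hb₂⟩ := hh'.exists_pos
  have hb₁ := hb₁.bound
  have hb₂ := hb₂.bound
  set K : ℝ := 1 + n * (2 * k) with hK
  have hK0 : 0 ≤ K := by positivity
  set C : ℝ := C₁ * K ^ (N + 1) + C₂ with hC
  have hC0 : 0 < C := by positivity
  have hsmall : ∀ᶠ y : EuclideanSpace ℝ (Fin n) in 𝓝 0, ‖y‖ < min 1 (1 / C) := by
    have := Metric.ball_mem_nhds (0 : EuclideanSpace ℝ (Fin n))
      (show 0 < min 1 (1 / C) by positivity)
    filter_upwards [this] with y hy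
    simpa using hy
  have main : ∀ᶠ y : EuclideanSpace ℝ (Fin n) in 𝓝 0, y ≠ 0 → g y = ‖y‖ ^ (2 * k) →
      2 * k * ‖y‖ ^ (2 * k - 1) < ‖gradient f (p + y)‖ := by
    filter_upwards [hb₁, hb₂, hsmall] with y h1 h2 h3 hy0 hgy
    by_contra hcon
    push Not at hcon
    have hr0 : 0 < ‖y‖ := norm_pos_iff.2 hy0
    set r := ‖y‖ with hr
    have hr1 : r < 1 := lt_of_lt_of_le h3 (min_le_left _ _)
    have hrC : r < 1 / C := lt_of_lt_of_le h3 (min_le_right _ _)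
    have hrC' : C * r < 1 := by
      rw [lt_div_iff₀ hC0] at hrC; linarith
    rw [norm_gradient_eq, ← hfd] at hcon
    have hd : ∀ i, |fderiv ℝ g y (EuclideanSpace.single i 1)| ≤ 2 * k * r ^ (2 * k - 1) := by
      intro i
      have h4 := (fderiv ℝ g y).le_opNorm (EuclideanSpace.single i (1 : ℝ))
      rw [Real.norm_eq_abs] at h4
      have h5 : ‖(EuclideanSpace.single i (1 : ℝ) : EuclideanSpace ℝ (Fin n))‖ = 1 := by simp
      rw [h5, mul_one] at h4
      exact h4.trans hcon
    have hφ : |g y| + ∑ i, |fderiv ℝ g y (EuclideanSpace.single i 1)| ≤ K * r ^ (2 * k - 1) := by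
      have h4 : |g y| ≤ r ^ (2 * k - 1) := by
        rw [hgy, abs_of_nonneg (by positivity)]
        exact pow_le_pow_of_le_one hr0.le hr1.le (by omega)
      have h5 : ∑ i : Fin n, |fderiv ℝ g y (EuclideanSpace.single i 1)| ≤
          ∑ i : Fin n, 2 * k * r ^ (2 * k - 1) := Finset.sum_le_sum fun i _ => hd i
      rw [Finset.sum_const, Finset.card_univ, Fintype.card_fin, nsmul_eq_mul] at h5
      rw [hK]; nlinarith
    have hφ0 : 0 ≤ |g y| + ∑ i, |fderiv ℝ g y (EuclideanSpace.single i 1)| :=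
      add_nonneg (abs_nonneg _) (Finset.sum_nonneg fun _ _ => abs_nonneg _)
    have e1 : |h y| ≤ C₁ * K ^ (N + 1) * r ^ (2 * k * N + 1) := by
      rw [Real.norm_eq_abs, Real.norm_eq_abs, abs_of_nonneg (pow_nonneg hφ0 _)] at h1
      calc |h y| ≤ _ := h1
        _ ≤ C₁ * (K * r ^ (2 * k - 1)) ^ (N + 1) := by gcongr
        _ = C₁ * K ^ (N + 1) * r ^ ((2 * k - 1) * (N + 1)) := by rw [mul_pow, ← pow_mul]; ring
        _ ≤ C₁ * K ^ (N + 1) * r ^ (2 * k * N + 1) := by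
          apply mul_le_mul_of_nonneg_left _ (by positivity)
          apply pow_le_pow_of_le_one hr0.le hr1.le
          obtain ⟨j, rfl⟩ : ∃ j, k = N + 1 + j := ⟨k - (N + 1), by omega⟩
          have : 2 * (N + 1 + j) - 1 = 2 * N + 1 + 2 * j := by omega
          rw [this]; nlinarith
    have e2 : |g y ^ N - h y| ≤ C₂ * r ^ (2 * k * N + 1) := by
      rw [Real.norm_eq_abs, Real.norm_eq_abs,
        abs_of_nonneg (show 0 ≤ r ^ (2 * k * N + 1) by positivity)] at h2
      exact h2
    have e3 : g y ^ N ≤ C * r ^ (2 * k * N + 1) := by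
      have := le_abs_self (h y)
      have := le_abs_self (g y ^ N - h y)
      rw [hC]; nlinarith
    rw [hgy, ← pow_mul, pow_succ] at e3
    have hp : 0 < r ^ (2 * k * N) := by positivity
    nlinarith
  have ht : Filter.Tendsto (fun x => x - p) (𝓝 p) (𝓝 0) := by
    have : Continuous (fun x : EuclideanSpace ℝ (Fin n) => x - p) := by fun_prop
    simpa using this.tendsto p
  filter_upwards [ht.eventually main] with x hx hxp hfx
  have := hx (sub_ne_zero.2 hxp) (by simpa [hgdef] using hfx)
  simpa using this

end gradineq

section flow
open Topology

/-- A gradient flow reaching a critical point in a region of Lipschitz gradient is constant. -/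
lemma flow_const {E : Type*} [NormedAddCommGroup E] [NormedSpace ℝ E] (v : E → E) (K : NNReal)
    (U : Set E) (hv : LipschitzOnWith K v U) (p : E) (hp : p ∈ U) (hvp : v p = 0)
    (γ : ℝ → E) (hγ : ∀ t, 0 ≤ t → HasDerivAt γ (v (γ t)) t) (hU : ∀ t, 0 ≤ t → γ t ∈ U)
    (t₀ : ℝ) (h0 : 0 ≤ t₀) (ht₀ : γ t₀ = p) (t : ℝ) (ht : 0 ≤ t) : γ t = p := by
  have hc : ∀ a b, 0 ≤ a → ContinuousOn γ (Set.Icc a b) := fun a b ha s hs =>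
    (hγ s (ha.trans hs.1)).continuousAt.continuousWithinAt
  rcases le_total t₀ t with h | h
  · have := ODE_solution_unique_of_mem_Icc_right (v := fun _ => v) (s := fun _ => U) (K := K)
      (f := γ) (g := fun _ => p) (a := t₀) (b := t) (fun _ _ => hv) (hc _ _ h0)
      (fun s hs => (hγ s (h0.trans hs.1)).hasDerivWithinAt) (fun s hs => hU s (h0.trans hs.1))
      continuousOn_const (fun s _ => by
        simp only [hvp]; exact hasDerivWithinAt_const _ _ _) (fun _ _ => hp) ht₀
    exact this ⟨h, le_rfl⟩
  · have := ODE_solution_unique_of_mem_Icc_left (v := fun _ => v) (s := fun _ => U) (K := K)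
      (f := γ) (g := fun _ => p) (a := t) (b := t₀) (fun _ _ => hv) (hc _ _ ht)
      (fun s hs => (hγ s (ht.trans hs.1.le)).hasDerivWithinAt)
      (fun s hs => hU s (ht.trans hs.1.le))
      continuousOn_const (fun s _ => by
        simp only [hvp]; exact hasDerivWithinAt_const _ _ _) (fun _ _ => hp) ht₀
    exact this ⟨le_rfl, h⟩

lemma zero_unique (τ : ℝ → ℝ) (hd : ∀ t, 0 ≤ t → DifferentiableAt ℝ τ t)
    (hneg : ∀ t, 0 ≤ t → τ t = 0 → deriv τ t < 0) (t₁ t₂ : ℝ) (h₁ : 0 ≤ t₁)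
    (h12 : t₁ < t₂) (hz₁ : τ t₁ = 0) (hz₂ : τ t₂ = 0) : False := by
  have hle := image_le_of_deriv_right_lt_deriv_boundary (f := τ) (f' := deriv τ) (a := t₁) (b := t₂)
    (fun s hs => (hd s (h₁.trans hs.1)).continuousAt.continuousWithinAt)
    (fun s hs => (hd s (h₁.trans hs.1)).hasDerivAt.hasDerivWithinAt)
    (B := fun _ => 0) (B' := fun _ => 0) hz₁.le (fun _ => hasDerivAt_const _ _)
    (fun s hs hs0 => hneg s (h₁.trans hs.1) hs0)
  have h2 := (hd t₂ (h₁.trans h12.le)).hasDerivAt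
  have hn := hneg t₂ (h₁.trans h12.le) hz₂
  rw [hasDerivAt_iff_tendsto_slope] at h2
  have h3 := h2.eventually (gt_mem_nhds hn)
  have h4 : ∀ᶠ s in 𝓝[<] t₂, slope τ t₂ s < 0 :=
    h3.filter_mono (nhdsWithin_mono _ fun s hs => ne_of_lt hs)
  have h5 : ∀ᶠ s in 𝓝[<] t₂, s ∈ Set.Ioo t₁ t₂ := Ioo_mem_nhdsLT h12
  obtain ⟨s, hs, hs'⟩ := (h4.and h5).exists
  have h6 := hle ⟨hs'.1.le, hs'.2.le⟩
  rw [slope_def_field, hz₂, sub_zero] at hs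
  have h7 : 0 ≤ τ s / (s - t₂) := div_nonneg_of_nonpos h6 (by linarith [hs'.2])
  linarith

end flow

open Filter

/-- For an analytic `f` with local minimum `p` and every sufficiently
large `k`, there is an open neighborhood `U` of `p` such that any nonconstant gradient
flow staying in `U` crosses the set `Z = {x : f x − f p = ‖x − p‖^{2k}}` at most once,
and transversally: `τ(t) = f (γ t) − f p − ‖γ t − p‖^{2k}` has at most one zero, with
negative derivative at any zero. -/
theorem gradient_flow_crosses_Z_once
    (n : ℕ)
    (f : EuclideanSpace ℝ (Fin n) → ℝ)
    (hf : ∀ x, AnalyticAt ℝ f x)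
    (p : EuclideanSpace ℝ (Fin n))
    (hmin : IsLocalMin f p) :
    ∃ k₀ : ℕ, ∀ k : ℕ, k₀ ≤ k →
      ∃ U : Set (EuclideanSpace ℝ (Fin n)), IsOpen U ∧ p ∈ U ∧
        ∀ γ : ℝ → EuclideanSpace ℝ (Fin n),
          (∀ t : ℝ, 0 ≤ t → HasDerivAt γ (-(gradient f (γ t))) t) →
          (∀ t : ℝ, 0 ≤ t → γ t ∈ U) →
          (∃ t₁ t₂ : ℝ, 0 ≤ t₁ ∧ 0 ≤ t₂ ∧ γ t₁ ≠ γ t₂) →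
          (∀ t₁ t₂ : ℝ, 0 ≤ t₁ → 0 ≤ t₂ →
              f (γ t₁) - f p = ‖γ t₁ - p‖ ^ (2 * k) →
              f (γ t₂) - f p = ‖γ t₂ - p‖ ^ (2 * k) → t₁ = t₂) ∧
          (∀ t : ℝ, 0 ≤ t → f (γ t) - f p = ‖γ t - p‖ ^ (2 * k) →
            deriv (fun ζ => f (γ ζ) - f p - ‖γ ζ - p‖ ^ (2 * k)) t < 0) := by
  have hfd : ∀ x, HasGradientAt f (gradient f x) x :=
    fun x => (hf x).differentiableAt.hasGradientAt
  have hgp : gradient f p = 0 := by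
    have h1 := hmin.fderiv_eq_zero
    have h2 := norm_gradient_eq f p
    rw [h1, norm_zero, norm_eq_zero] at h2
    exact h2
  have hlip : ∃ K : NNReal, ∃ s ∈ nhds p,
      LipschitzOnWith K (fun x => -(gradient f x)) s := by
    obtain ⟨K, s, hs, hK⟩ := (hf p).fderiv.hasStrictFDerivAt.exists_lipschitzOnWith
    refine ⟨K, s, hs, LipschitzOnWith.of_dist_le_mul fun x hx y hy => ?_⟩
    have h1 := hK.dist_le_mul x hx y hy
    rw [← toDual_gradient, ← toDual_gradient, LinearIsometryEquiv.dist_map] at h1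
    rw [dist_neg_neg]
    exact h1
  obtain ⟨K, s, hs, hK⟩ := hlip
  obtain ⟨k₀, hk₀⟩ := grad_ineq f p (hf p)
  refine ⟨k₀, fun k hk => ?_⟩
  obtain ⟨hk1, hev⟩ := hk₀ k hk
  obtain ⟨U, hUs, hUo, hpU⟩ := mem_nhds_iff.1 (Filter.inter_mem hs hev)
  refine ⟨U, hUo, hpU, fun γ hγ hγU hnc => ?_⟩
  have hnp : ∀ t, 0 ≤ t → γ t ≠ p := by
    intro t ht htp
    obtain ⟨t₁, t₂, h1, h2, h12⟩ := hnc
    have key := flow_const (fun x => -(gradient f x)) K U (hK.mono fun x hx => (hUs hx).1) p hpU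
      (by simp [hgp]) γ hγ hγU t ht htp
    exact h12 ((key t₁ h1).trans (key t₂ h2).symm)
  have hder : ∀ t, 0 ≤ t → HasDerivAt (fun ζ => f (γ ζ) - f p - ‖γ ζ - p‖ ^ (2 * k))
      (-‖gradient f (γ t)‖ ^ 2 + 2 * k * ‖γ t - p‖ ^ (2 * (k - 1)) *
        inner ℝ (γ t - p) (gradient f (γ t))) t := by
    intro t ht
    have h1 := (hfd (γ t)).hasFDerivAt.comp_hasDerivAt t (hγ t ht)
    have h2 := (((hγ t ht).sub_const p).norm_sq).pow k
    have h3 := (h1.sub_const (f p)).sub h2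
    convert! h3 using 1
    · funext ζ
      simp [pow_mul]
    · simp only [InnerProductSpace.toDual_apply_apply, inner_neg_right,
        real_inner_self_eq_norm_sq, Pi.pow_apply, pow_mul]
      ring
  have hneg : ∀ t, 0 ≤ t → f (γ t) - f p = ‖γ t - p‖ ^ (2 * k) →
      deriv (fun ζ => f (γ ζ) - f p - ‖γ ζ - p‖ ^ (2 * k)) t < 0 := by
    intro t ht hz
    rw [(hder t ht).deriv]
    have h1 := (hUs (hγU t ht)).2 (hnp t ht) hz
    have h2 := real_inner_le_norm (γ t - p) (gradient f (γ t))
    have e : 2 * k - 1 = 2 * (k - 1) + 1 := by omega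
    rw [e, pow_succ] at h1
    set r := ‖γ t - p‖
    set G := ‖gradient f (γ t)‖
    set c : ℝ := 2 * k * r ^ (2 * (k - 1)) with hc
    have hc0 : 0 ≤ c := by positivity
    have hr0 : 0 ≤ r := norm_nonneg _
    have h3 : c * r < G := by rw [hc]; linarith
    have h4 : 0 < G := lt_of_le_of_lt (mul_nonneg hc0 hr0) h3
    have h5 := mul_le_mul_of_nonneg_left h2 hc0
    nlinarith
  have hdiff : ∀ t, 0 ≤ t →
      DifferentiableAt ℝ (fun ζ => f (γ ζ) - f p - ‖γ ζ - p‖ ^ (2 * k)) t :=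
    fun t ht => (hder t ht).differentiableAt
  refine ⟨?_, hneg⟩
  intro t₁ t₂ h1 h2 hz1 hz2
  have hneg' : ∀ t, 0 ≤ t → (fun ζ => f (γ ζ) - f p - ‖γ ζ - p‖ ^ (2 * k)) t = 0 →
      deriv (fun ζ => f (γ ζ) - f p - ‖γ ζ - p‖ ^ (2 * k)) t < 0 :=
    fun t ht hz => hneg t ht (sub_eq_zero.1 hz)
  rcases lt_trichotomy t₁ t₂ with h | h | h
  · exact (zero_unique _ hdiff hneg' t₁ t₂ h1 h (sub_eq_zero.2 hz1) (sub_eq_zero.2 hz2)).elim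
  · exact h
  · exact (zero_unique _ hdiff hneg' t₂ t₁ h2 h (sub_eq_zero.2 hz2) (sub_eq_zero.2 hz1)).elim
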